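/- Let k ≥ 2 be an integer. For every real number l ≥ 2, (1/(2πi)) ∑_{0 < |n| ≤ k^l} ζ(2nπi/log k) / n = O_k(1), i.e. these partial sums are bounded by a constant depending only on k. -/

import Mathlib

open Complex

/-- Summation by parts: a monotone bounded weight against the differences of a bounded sequence. -/
lemma norm_sum_mul_sub_le {u : ℕ → ℂ} {h : ℕ → ℝ} {a b : ℕ} {B U : ℝ} (hU : 0 ≤ U) (hB : 0 ≤ B)
    (hu : ∀ i, a ≤ i → i ≤ b → ‖u i‖ ≤ U)
    (hh : ∀ i, a ≤ i → i + 1 < b → h (i + 1) ≤ h i)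
    (hhB : ∀ i, a ≤ i → i < b → |h i| ≤ B) :
    ‖∑ i ∈ Finset.Ico a b, (h i : ℂ) * (u i - u (i + 1))‖ ≤ 4 * B * U := by
  have key : ∀ c, a ≤ c → c < b →
      ‖∑ i ∈ Finset.Ico a (c + 1), (h i : ℂ) * (u i - u (i + 1)) + (h c : ℂ) * u (c + 1)‖
        ≤ U * (|h a| + h a - h c) := by
    intro c hac
    induction c, hac using Nat.le_induction with
    | base =>
      intro hb
      have : ∑ i ∈ Finset.Ico a (a + 1), (h i : ℂ) * (u i - u (i + 1)) + (h a : ℂ) * u (a + 1)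
          = (h a : ℂ) * u a := by
        simp; ring
      rw [this, norm_mul, Complex.norm_real, Real.norm_eq_abs]
      nlinarith [hu a le_rfl hb.le, abs_nonneg (h a)]
    | succ c hac ih =>
      intro hb
      have h1 := ih (by omega)
      have : ∑ i ∈ Finset.Ico a (c + 1 + 1), (h i : ℂ) * (u i - u (i + 1))
          + (h (c + 1) : ℂ) * u (c + 1 + 1)
          = (∑ i ∈ Finset.Ico a (c + 1), (h i : ℂ) * (u i - u (i + 1)) + (h c : ℂ) * u (c + 1))
            + ((h (c + 1) - h c : ℝ) : ℂ) * u (c + 1) := by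
        rw [Finset.sum_Ico_succ_top (by omega)]
        push_cast
        ring
      rw [this]
      refine (norm_add_le _ _).trans ?_
      rw [norm_mul, Complex.norm_real, Real.norm_eq_abs,
        abs_of_nonpos (sub_nonpos.2 (hh c hac hb))]
      nlinarith [hu (c + 1) (by omega) hb.le, hh c hac hb]
  rcases le_or_gt b a with hab | hab
  · rw [Finset.Ico_eq_empty_of_le hab]
    simp
    positivity
  · obtain ⟨c, rfl⟩ : ∃ c, b = c + 1 := ⟨b - 1, by omega⟩
    have h1 := key c (by omega) (by omega)
    have h2 : ‖(h c : ℂ) * u (c + 1)‖ ≤ B * U := by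
      rw [norm_mul, Complex.norm_real, Real.norm_eq_abs]
      exact mul_le_mul (hhB c (by omega) (by omega)) (hu _ (by omega) le_rfl) (norm_nonneg _) hB
    have h3 := norm_sub_le
      (∑ i ∈ Finset.Ico a (c + 1), (h i : ℂ) * (u i - u (i + 1)) + (h c : ℂ) * u (c + 1))
      ((h c : ℂ) * u (c + 1))
    rw [add_sub_cancel_right] at h3
    have h4 := abs_le.1 (hhB a le_rfl (by omega))
    have h5 := abs_le.1 (hhB c (by omega) (by omega))
    have h6 := hhB a le_rfl (by omega)
    nlinarith [mul_le_mul_of_nonneg_left (show |h a| + h a - h c ≤ 3 * B by linarith) hU]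

/-- Summation by parts: an antitone nonnegative weight against a sequence with bounded partial
sums. -/
lemma norm_sum_mul_le_of_partial_sums {v : ℕ → ℂ} {h : ℕ → ℝ} {a b : ℕ} {B U : ℝ}
    (hU : 0 ≤ U) (hB : 0 ≤ B)
    (hv : ∀ c, a ≤ c → c ≤ b → ‖∑ i ∈ Finset.Ico a c, v i‖ ≤ U)
    (hh : ∀ i, a ≤ i → i + 1 < b → h (i + 1) ≤ h i)
    (hhB : ∀ i, a ≤ i → i < b → |h i| ≤ B) :
    ‖∑ i ∈ Finset.Ico a b, (h i : ℂ) * v i‖ ≤ 4 * B * U := by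
  have := norm_sum_mul_sub_le (u := fun c ↦ ∑ i ∈ Finset.Ico a c, v i) hU hB hv hh hhB
  rw [← norm_neg, ← Finset.sum_neg_distrib] at this
  rwa [Finset.sum_congr rfl fun i hi ↦ ?_] at this
  rw [Finset.sum_Ico_succ_top (Finset.mem_Ico.1 hi).1]
  ring

/-- The additive character `x ↦ exp (2πix)`. -/
noncomputable def expTurn (x : ℝ) : ℂ := exp ((2 * Real.pi * x : ℝ) * I)

lemma norm_expTurn (x : ℝ) : ‖expTurn x‖ = 1 := norm_exp_ofReal_mul_I _

lemma expTurn_add (x y : ℝ) : expTurn (x + y) = expTurn x * expTurn y := by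
  rw [expTurn, expTurn, expTurn, ← exp_add]
  push_cast
  ring_nf

lemma expTurn_re (x : ℝ) : (expTurn x).re = Real.cos (2 * Real.pi * x) := by
  rw [expTurn, exp_ofReal_mul_I_re]

/-- With `s = sin (πd) ≠ 0`, `1 = (1 - e(d)) (1/2 + (i/2) cot (πd))`. -/
lemma one_sub_expTurn_mul {d : ℝ} (hd : Real.sin (Real.pi * d) ≠ 0) :
    (1 - expTurn d) * (1 / 2 + (I / 2) * (Real.cot (Real.pi * d) : ℝ)) = 1 := by
  have h1 : expTurn d = (Real.cos (Real.pi * d) + Real.sin (Real.pi * d) * I) ^ 2 := by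
    rw [ofReal_cos, ofReal_sin, ← exp_mul_I, ← exp_nat_mul, expTurn]
    push_cast
    ring_nf
  have h2 : (Real.sin (Real.pi * d) : ℂ) ^ 2 + (Real.cos (Real.pi * d) : ℂ) ^ 2 = 1 := by
    exact_mod_cast Real.sin_sq_add_cos_sq _
  have h3 : (Real.sin (Real.pi * d) : ℂ) ≠ 0 := by exact_mod_cast hd
  rw [h1, Real.cot_eq_cos_div_sin]
  push_cast at *
  field_simp
  generalize Complex.sin (Real.pi * d) = s at *
  generalize Complex.cos (Real.pi * d) = c at *
  have hI : I ^ 2 = -1 := I_sq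
  linear_combination (2 * s - (s + I * c)) * h2 - (s ^ 2 * (s + I * c) + 2 * s * c ^ 2) * hI

lemma cot_le_inv {x : ℝ} (hx : 0 < x) (hx2 : x ≤ Real.pi / 2) : Real.cot x ≤ 1 / x := by
  rw [Real.cot_eq_cos_div_sin, div_le_div_iff₀ (Real.sin_pos_of_pos_of_lt_pi hx
    (by linarith [Real.pi_pos])) hx]
  rcases hx2.lt_or_eq with h | h
  · have h1 := Real.lt_tan hx h
    have h2 := Real.cos_pos_of_mem_Ioo ⟨by linarith, h⟩
    rw [Real.tan_eq_sin_div_cos, lt_div_iff₀ h2] at h1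
    linarith
  · rw [h, Real.cos_pi_div_two]
    simp

lemma antitoneOn_cot : AntitoneOn Real.cot (Set.Ioo 0 Real.pi) := by
  intro x hx y hy hxy
  have h1 := Real.sin_pos_of_pos_of_lt_pi hx.1 hx.2
  have h2 := Real.sin_pos_of_pos_of_lt_pi hy.1 hy.2
  rw [Real.cot_eq_cos_div_sin, Real.cot_eq_cos_div_sin, div_le_div_iff₀ h2 h1]
  have h3 : 0 ≤ Real.sin (y - x) :=
    Real.sin_nonneg_of_nonneg_of_le_pi (by linarith) (by linarith [hx.1, hy.2])
  rw [Real.sin_sub] at h3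
  linarith

lemma abs_cot_le {x θ : ℝ} (hθ : 0 < θ) (h1 : θ ≤ x) (h2 : x ≤ 1 - θ) :
    |Real.cot (Real.pi * x)| ≤ 1 / θ := by
  have hp := Real.pi_pos
  have hp3 := Real.pi_gt_three
  have hθ2 : θ ≤ 1 / 2 := by linarith
  have h3 : Real.cot (Real.pi * θ) ≤ 1 / θ := by
    refine (cot_le_inv (by positivity) (by nlinarith)).trans ?_
    exact one_div_le_one_div_of_le hθ (by nlinarith)
  have h4 : Real.cot (Real.pi * (1 - θ)) = - Real.cot (Real.pi * θ) := by
    rw [show Real.pi * (1 - θ) = Real.pi - Real.pi * θ by ring, Real.cot_eq_cos_div_sin,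
      Real.cot_eq_cos_div_sin, Real.cos_pi_sub, Real.sin_pi_sub, neg_div]
  have m0 : Real.pi * θ ∈ Set.Ioo 0 Real.pi := ⟨by positivity, by nlinarith⟩
  have m1 : Real.pi * x ∈ Set.Ioo 0 Real.pi := ⟨by nlinarith, by nlinarith⟩
  have m2 : Real.pi * (1 - θ) ∈ Set.Ioo 0 Real.pi := ⟨by nlinarith, by nlinarith⟩
  have h5 := antitoneOn_cot m0 m1 (by nlinarith)
  have h6 := antitoneOn_cot m1 m2 (by nlinarith)
  rw [abs_le]
  constructor <;> linarith

lemma expTurn_sub_int (x : ℝ) (n : ℤ) : expTurn (x - n) = expTurn x := by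
  rw [expTurn, expTurn, exp_eq_exp_iff_exists_int]
  refine ⟨-n, ?_⟩
  push_cast
  ring

/-- The Kusmin–Landau inequality. -/
lemma kusmin_landau {F : ℕ → ℝ} {a b : ℕ} {θ : ℝ} {ν : ℤ} (hθ : 0 < θ)
    (hF : ∀ i, a ≤ i → i + 1 < b → F (i + 2) - F (i + 1) ≤ F (i + 1) - F i)
    (h1 : ∀ i, a ≤ i → i < b → ν + θ ≤ F (i + 1) - F i)
    (h2 : ∀ i, a ≤ i → i < b → F (i + 1) - F i ≤ ν + 1 - θ) :
    ‖∑ i ∈ Finset.Ico a b, expTurn (F i)‖ ≤ 3 / θ := by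
  rcases le_or_gt b a with hab | hab
  · rw [Finset.Ico_eq_empty_of_le hab]
    simp
    positivity
  have hp := Real.pi_pos
  have hθ2 : θ ≤ 1 / 2 := by linarith [h1 a le_rfl hab, h2 a le_rfl hab]
  set d : ℕ → ℝ := fun i ↦ F (i + 1) - F i - ν with hd
  have hd1 : ∀ i, a ≤ i → i < b → θ ≤ d i := fun i hi hi' ↦ by
    have := h1 i hi hi'; simp only [hd]; linarith
  have hd2 : ∀ i, a ≤ i → i < b → d i ≤ 1 - θ := fun i hi hi' ↦ by
    have := h2 i hi hi'; simp only [hd]; linarith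
  have hm : ∀ i, a ≤ i → i < b → Real.pi * d i ∈ Set.Ioo 0 Real.pi := fun i hi hi' ↦
    ⟨mul_pos hp (by linarith [hd1 i hi hi']), by nlinarith [hd2 i hi hi']⟩
  have hterm : ∀ i ∈ Finset.Ico a b, expTurn (F i) =
      (1 / 2) * (expTurn (F i) - expTurn (F (i + 1)))
        - (I / 2) * (((-Real.cot (Real.pi * d i) : ℝ) : ℂ)
          * (expTurn (F i) - expTurn (F (i + 1)))) := by
    intro i hi
    rw [Finset.mem_Ico] at hi
    have hs := Real.sin_pos_of_mem_Ioo (hm i hi.1 hi.2)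
    have h3 := one_sub_expTurn_mul hs.ne'
    have h4 : expTurn (F (i + 1)) = expTurn (F i) * expTurn (d i) := by
      rw [← expTurn_add, ← expTurn_sub_int _ ν]
      congr 1
      simp only [hd]; ring
    rw [h4, ofReal_neg]
    linear_combination (-expTurn (F i)) * h3
  rw [Finset.sum_congr rfl hterm, Finset.sum_sub_distrib, ← Finset.mul_sum, ← Finset.mul_sum]
  have h5 : ‖∑ i ∈ Finset.Ico a b, (expTurn (F i) - expTurn (F (i + 1)))‖ ≤ 2 := by
    rw [← norm_neg, ← Finset.sum_neg_distrib]
    simp only [neg_sub]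
    rw [Finset.sum_Ico_sub (fun i ↦ expTurn (F i)) hab.le]
    refine (norm_sub_le _ _).trans ?_
    rw [norm_expTurn, norm_expTurn]
    norm_num
  have h6 : ‖∑ i ∈ Finset.Ico a b, ((-Real.cot (Real.pi * d i) : ℝ) : ℂ)
      * (expTurn (F i) - expTurn (F (i + 1)))‖ ≤ 4 * (1 / θ) * 1 := by
    apply norm_sum_mul_sub_le (u := fun i ↦ expTurn (F i)) zero_le_one (by positivity)
    · intro i _ _
      exact (norm_expTurn _).le
    · intro i hi hi'
      have := antitoneOn_cot (hm (i + 1) (by omega) hi') (hm i hi (by omega)) (by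
        have := hF i hi hi'
        apply mul_le_mul_of_nonneg_left _ hp.le
        simp only [hd]
        linarith)
      linarith
    · intro i hi hi'
      rw [abs_neg]
      exact abs_cot_le hθ (hd1 i hi hi') (hd2 i hi hi')
  refine (norm_sub_le _ _).trans ?_
  rw [norm_mul, norm_mul]
  have h7 : ‖(1 / 2 : ℂ)‖ = 1 / 2 := by norm_num
  have h8 : ‖(I / 2 : ℂ)‖ = 1 / 2 := by norm_num
  rw [h7, h8]
  have h9 : (1 : ℝ) ≤ 1 / θ := by
    rw [le_div_iff₀ hθ]; linarith
  have : 3 / θ = 3 * (1 / θ) := by ring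
  rw [this]
  linarith

lemma mul_le_sub_of_gap {d : ℕ → ℝ} {a b : ℕ} {δ : ℝ}
    (h : ∀ i, a ≤ i → i + 1 < b → δ ≤ d i - d (i + 1)) {i j : ℕ} (hi : a ≤ i) (hij : i ≤ j)
    (hj : j < b) : ((j : ℝ) - i) * δ ≤ d i - d j := by
  induction j, hij using Nat.le_induction with
  | base => simp
  | succ j hij ih =>
    have h1 := ih (by omega)
    have h2 := h j (by omega) hj
    push_cast
    linarith

lemma card_le_of_gap {d : ℕ → ℝ} {a b : ℕ} {δ θ x : ℝ} (hδ : 0 < δ) (hθ : 0 ≤ θ)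
    (h : ∀ i, a ≤ i → i + 1 < b → δ ≤ d i - d (i + 1)) {s : Finset ℕ}
    (hs : s ⊆ Finset.Ico a b) (hx : ∀ i ∈ s, x ≤ d i) (hx' : ∀ i ∈ s, d i ≤ x + θ) :
    (s.card : ℝ) ≤ θ / δ + 1 := by
  rcases s.eq_empty_or_nonempty with rfl | hne
  · simp
    positivity
  have hmin := s.min'_mem hne
  have hmax := s.max'_mem hne
  have hle := s.min'_le_max' hne
  have h1 := mul_le_sub_of_gap h (Finset.mem_Ico.1 (hs hmin)).1 hle (Finset.mem_Ico.1 (hs hmax)).2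
  have h2 := hx _ hmax
  have h3 := hx' _ hmin
  have h4 : s ⊆ Finset.Icc (s.min' hne) (s.max' hne) := fun i hi ↦
    Finset.mem_Icc.2 ⟨s.min'_le i hi, s.le_max' i hi⟩
  have h5 := Finset.card_le_card h4
  rw [Nat.card_Icc] at h5
  have h6 : (s.card : ℝ) ≤ s.max' hne + 1 - s.min' hne := by
    rw [← Nat.cast_add_one, ← Nat.cast_sub (by omega)]
    exact_mod_cast h5
  have h7 : (s.max' hne : ℝ) - s.min' hne ≤ θ / δ := by
    rw [le_div_iff₀ hδ]
    linarith
  linarith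

/-- The part of the second derivative test where the differences share their integer part. -/
lemma norm_sum_expTurn_fiber_le {F : ℕ → ℝ} {a b : ℕ} {δ : ℝ} {ν : ℤ} (hδ : 0 < δ)
    (h : ∀ i, a ≤ i → i + 1 < b → δ ≤ (F (i + 1) - F i) - (F (i + 2) - F (i + 1))) :
    ‖∑ i ∈ Finset.Ico a b with ⌊F (i + 1) - F i⌋ = ν, expTurn (F i)‖
      ≤ 5 * (1 / √δ + 1) := by
  set d : ℕ → ℝ := fun i ↦ F (i + 1) - F i with hd
  have hgap : ∀ i, a ≤ i → i + 1 < b → δ ≤ d i - d (i + 1) := h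
  have hθ : 0 < √δ := Real.sqrt_pos.2 hδ
  have hθδ : √δ / δ = 1 / √δ := by
    rw [div_eq_div_iff hδ.ne' hθ.ne', one_mul, Real.mul_self_sqrt hδ.le]
  have hcard : ∀ s : Finset ℕ, ‖∑ i ∈ s, expTurn (F i)‖ ≤ s.card := fun s ↦ by
    refine (norm_sum_le _ _).trans ?_
    simp [norm_expTurn]
  set S := {i ∈ Finset.Ico a b | ⌊d i⌋ = ν} with hS
  have hSsub : S ⊆ Finset.Ico a b := Finset.filter_subset _ _
  have hSm : ∀ i ∈ S, (ν : ℝ) ≤ d i ∧ d i < ν + 1 := fun i hi ↦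
    Int.floor_eq_iff.1 (Finset.mem_filter.1 hi).2
  change ‖∑ i ∈ S, expTurn (F i)‖ ≤ _
  rw [← Finset.sum_filter_add_sum_filter_not S (fun i ↦ d i < ν + √δ),
    ← Finset.sum_filter_add_sum_filter_not (S.filter fun i ↦ ¬ d i < ν + √δ)
      (fun i ↦ ν + 1 - √δ < d i)]
  set S₁ := S.filter fun i ↦ d i < ν + √δ with hS₁
  set S₂ := (S.filter fun i ↦ ¬ d i < ν + √δ).filter fun i ↦ ν + 1 - √δ < d i with hS₂
  set S₃ := (S.filter fun i ↦ ¬ d i < ν + √δ).filter fun i ↦ ¬ ν + 1 - √δ < d i with hS₃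
  have b1 : (S₁.card : ℝ) ≤ √δ / δ + 1 := by
    apply card_le_of_gap (x := ν) hδ hθ.le hgap ((Finset.filter_subset _ _).trans hSsub)
    · exact fun i hi ↦ (hSm i (Finset.mem_filter.1 hi).1).1
    · exact fun i hi ↦ (Finset.mem_filter.1 hi).2.le
  have b2 : (S₂.card : ℝ) ≤ √δ / δ + 1 := by
    apply card_le_of_gap (x := ν + 1 - √δ) hδ hθ.le hgap
      (((Finset.filter_subset _ _).trans (Finset.filter_subset _ _)).trans hSsub)
    · exact fun i hi ↦ (Finset.mem_filter.1 hi).2.le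
    · intro i hi
      have := (hSm i (Finset.mem_filter.1 (Finset.mem_filter.1 hi).1).1).2
      linarith
  have b3 : ‖∑ i ∈ S₃, expTurn (F i)‖ ≤ 3 / √δ := by
    have hmem : ∀ i, i ∈ S₃ ↔ (a ≤ i ∧ i < b) ∧ ν + √δ ≤ d i ∧ d i ≤ ν + 1 - √δ := by
      intro i
      simp only [hS₃, hS, Finset.mem_filter, Finset.mem_Ico, not_lt]
      constructor
      · tauto
      · rintro ⟨h1, h2, h3⟩
        refine ⟨⟨⟨h1, Int.floor_eq_iff.2 ⟨by linarith, by linarith⟩⟩, h2⟩, h3⟩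
    rcases S₃.eq_empty_or_nonempty with he | hne
    · rw [he, Finset.sum_empty, norm_zero]
      positivity
    have hmin := (hmem _).1 (S₃.min'_mem hne)
    have hmax := (hmem _).1 (S₃.max'_mem hne)
    have heq : S₃ = Finset.Ico (S₃.min' hne) (S₃.max' hne + 1) := by
      ext i
      constructor
      · intro hi
        exact Finset.mem_Ico.2 ⟨S₃.min'_le i hi, Nat.lt_succ_of_le (S₃.le_max' i hi)⟩
      · intro hi
        rw [Finset.mem_Ico] at hi
        have i1 := mul_le_sub_of_gap hgap hmin.1.1 hi.1 (by omega)
        have i2 := mul_le_sub_of_gap hgap (i := i) (by omega) (Nat.le_of_lt_succ hi.2) hmax.1.2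
        have i3 : (0 : ℝ) ≤ (i : ℝ) - (S₃.min' hne : ℕ) := by
          rw [sub_nonneg]; exact_mod_cast hi.1
        have i4 : (0 : ℝ) ≤ (S₃.max' hne : ℕ) - (i : ℝ) := by
          rw [sub_nonneg]; exact_mod_cast Nat.le_of_lt_succ hi.2
        refine (hmem i).2 ⟨⟨by omega, by omega⟩, ?_, ?_⟩
        · nlinarith [mul_nonneg i4 hδ.le]
        · nlinarith [mul_nonneg i3 hδ.le]
    have hin : ∀ i, S₃.min' hne ≤ i → i < S₃.max' hne + 1 →
        ν + √δ ≤ d i ∧ d i ≤ ν + 1 - √δ := fun i hi hi' ↦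
      ((hmem i).1 (by rw [heq]; exact Finset.mem_Ico.2 ⟨hi, hi'⟩)).2
    rw [heq]
    apply kusmin_landau (ν := ν) hθ
    · intro i hi hi'
      have := h i (by omega) (by omega)
      linarith
    · exact fun i hi hi' ↦ (hin i hi hi').1
    · exact fun i hi hi' ↦ (hin i hi hi').2
  have n1 := norm_add_le (∑ i ∈ S₁, expTurn (F i))
    (∑ i ∈ S₂, expTurn (F i) + ∑ i ∈ S₃, expTurn (F i))
  have n2 := norm_add_le (∑ i ∈ S₂, expTurn (F i)) (∑ i ∈ S₃, expTurn (F i))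
  have n3 := hcard S₁
  have n4 := hcard S₂
  rw [hθδ] at b1 b2
  have : 3 / √δ = 3 * (1 / √δ) := by ring
  linarith

/-- Van der Corput's second derivative test. -/
lemma van_der_corput {F : ℕ → ℝ} {a b : ℕ} {δ μ : ℝ} (hδ : 0 < δ) (hμ : 0 ≤ μ)
    (h : ∀ i, a ≤ i → i + 1 < b → δ ≤ (F (i + 1) - F i) - (F (i + 2) - F (i + 1)))
    (h' : ∀ i, a ≤ i → i + 1 < b → (F (i + 1) - F i) - (F (i + 2) - F (i + 1)) ≤ μ) :
    ‖∑ i ∈ Finset.Ico a b, expTurn (F i)‖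
      ≤ (μ * b + 2) * (5 * (1 / √δ + 1)) := by
  set d : ℕ → ℝ := fun i ↦ F (i + 1) - F i with hd
  have hgap : ∀ i, a ≤ i → i + 1 < b → δ ≤ d i - d (i + 1) := h
  have hgap' : ∀ i, a ≤ i → i + 1 < b → -μ ≤ (-d) i - (-d) (i + 1) := fun i hi hi' ↦ by
    have := h' i hi hi'
    simp only [hd, Pi.neg_apply] at *
    linarith
  rcases le_or_gt b a with hab | hab
  · rw [Finset.Ico_eq_empty_of_le hab]
    simp
    positivity
  have hmaps : ∀ i ∈ Finset.Ico a b, ⌊d i⌋ ∈ Finset.Icc ⌊d (b - 1)⌋ ⌊d a⌋ := by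
    intro i hi
    rw [Finset.mem_Ico] at hi
    have h1 := mul_le_sub_of_gap hgap le_rfl hi.1 hi.2
    have h2 := mul_le_sub_of_gap hgap hi.1 (show i ≤ b - 1 by omega) (by omega)
    have h3 : (a : ℝ) ≤ i := by exact_mod_cast hi.1
    have h4 : (i : ℝ) ≤ (b - 1 : ℕ) := by exact_mod_cast (show i ≤ b - 1 by omega)
    refine Finset.mem_Icc.2 ⟨Int.floor_le_floor ?_, Int.floor_le_floor ?_⟩ <;> nlinarith
  rw [← Finset.sum_fiberwise_of_maps_to hmaps]
  refine (norm_sum_le_of_le _ fun ν _ ↦ norm_sum_expTurn_fiber_le hδ h).trans ?_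
  rw [Finset.sum_const, nsmul_eq_mul]
  apply mul_le_mul_of_nonneg_right _ (by positivity)
  rw [Int.card_Icc]
  have h1 := mul_le_sub_of_gap hgap' le_rfl (show a ≤ b - 1 by omega) (by omega)
  simp only [Pi.neg_apply] at h1
  have h2 : ((b - 1 : ℕ) : ℝ) = b - 1 := by
    rw [Nat.cast_sub (by omega)]; simp
  rw [h2] at h1
  have h3 := (hmaps a (Finset.mem_Ico.2 ⟨le_rfl, hab⟩))
  rw [Finset.mem_Icc] at h3
  have h4 : (((⌊d a⌋ + 1 - ⌊d (b - 1)⌋).toNat : ℕ) : ℝ) = ⌊d a⌋ + 1 - ⌊d (b - 1)⌋ := by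
    have : (((⌊d a⌋ + 1 - ⌊d (b - 1)⌋).toNat : ℕ) : ℤ) = ⌊d a⌋ + 1 - ⌊d (b - 1)⌋ :=
      Int.toNat_of_nonneg (by omega)
    exact_mod_cast this
  rw [h4]
  have h5 := Int.floor_le (d a)
  have h6 := Int.lt_floor_add_one (d (b - 1))
  have h7 : 0 ≤ μ * (1 + a) := by positivity
  linarith

/-- The remainder in the Fourier expansion `∑ sin (2πny) / n = π (1/2 - y)` after `N` terms. -/
noncomputable def sineRemainder (N : ℕ) (y : ℝ) : ℝ :=
  ∑ n ∈ Finset.range N, Real.sin (2 * Real.pi * (n + 1) * y) / (n + 1) - Real.pi * (1 / 2 - y)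

lemma sin_mul_dirichlet_kernel (N : ℕ) (x : ℝ) :
    Real.sin x * (1 + 2 * ∑ n ∈ Finset.range N, Real.cos (2 * (n + 1) * x))
      = Real.sin ((2 * N + 1) * x) := by
  induction N with
  | zero => simp
  | succ N ih =>
    rw [Finset.sum_range_succ, mul_add 2, ← add_assoc, mul_add, ih]
    have h1 : ((2 * ((N + 1 : ℕ) : ℝ) + 1) * x) = 2 * (N + 1) * x + x := by push_cast; ring
    have h2 : (2 * (N : ℝ) + 1) * x = 2 * (N + 1) * x - x := by ring
    rw [h1, h2, Real.sin_add, Real.sin_sub]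
    ring

lemma two_mul_le_sin_pi_mul {y : ℝ} (h0 : 0 ≤ y) (h1 : y ≤ 1 / 2) :
    2 * y ≤ Real.sin (Real.pi * y) := by
  have hp := Real.pi_pos
  have := Real.mul_le_sin (x := Real.pi * y) (by positivity) (by nlinarith)
  have h2 : 2 / Real.pi * (Real.pi * y) = 2 * y := by field_simp
  linarith

lemma hasDerivAt_sineRemainder (N : ℕ) {y : ℝ} (hy : Real.sin (Real.pi * y) ≠ 0) :
    HasDerivAt (sineRemainder N)
      (Real.pi * Real.sin ((2 * N + 1) * (Real.pi * y)) / Real.sin (Real.pi * y)) y := by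
  have h1 : HasDerivAt (sineRemainder N) (∑ n ∈ Finset.range N,
      (Real.cos (2 * Real.pi * (n + 1) * y) * (2 * Real.pi * (n + 1) * 1)) / (n + 1)
        - Real.pi * (0 - 1)) y := by
    unfold sineRemainder
    refine HasDerivAt.sub ?_ (((hasDerivAt_const _ _).sub (hasDerivAt_id y)).const_mul _)
    refine HasDerivAt.fun_sum fun n _ ↦ ?_
    exact (((hasDerivAt_id y).const_mul _).sin).div_const _
  convert h1 using 1
  rw [← sin_mul_dirichlet_kernel, ← mul_assoc, mul_right_comm, mul_div_assoc,
    div_self hy, mul_one, mul_add, Finset.mul_sum, Finset.mul_sum]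
  have : ∀ n ∈ Finset.range N,
      Real.cos (2 * Real.pi * (n + 1) * y) * (2 * Real.pi * (n + 1) * 1) / (n + 1)
      = Real.pi * (2 * Real.cos (2 * (n + 1) * (Real.pi * y))) := by
    intro n _
    have : (n : ℝ) + 1 ≠ 0 := by positivity
    rw [show 2 * Real.pi * (n + 1) * y = 2 * (n + 1) * (Real.pi * y) by ring]
    field_simp
  rw [Finset.sum_congr rfl this]
  ring

lemma sineRemainder_half (N : ℕ) : sineRemainder N (1 / 2) = 0 := by
  unfold sineRemainder
  rw [Finset.sum_eq_zero]
  · ring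
  · intro n _
    have := Real.sin_nat_mul_pi (n + 1)
    rw [show 2 * Real.pi * (n + 1) * (1 / 2) = ((n + 1 : ℕ) : ℝ) * Real.pi by push_cast; ring, this]
    simp

lemma cos_odd_mul_pi_div_two (N : ℕ) : Real.cos ((2 * N + 1) * (Real.pi * (1 / 2))) = 0 := by
  rw [Real.cos_eq_zero_iff]
  exact ⟨N, by push_cast; ring⟩

lemma sin_pi_mul_pos {y : ℝ} (h0 : 0 < y) (h1 : y ≤ 1 / 2) : 0 < Real.sin (Real.pi * y) := by
  linarith [two_mul_le_sin_pi_mul h0.le h1]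

lemma abs_sineRemainder_sub_le (N : ℕ) {x y : ℝ} (hx : 0 < x) (hxy : x ≤ y) (hy : y ≤ 1 / 2) :
    |sineRemainder N y - sineRemainder N x| ≤ Real.pi / (2 * x) * (y - x) := by
  have hp := Real.pi_pos
  have := Convex.norm_image_sub_le_of_norm_hasDerivWithin_le (f := sineRemainder N)
    (s := Set.Icc x y) (x := x) (y := y) (C := Real.pi / (2 * x))
    (fun z hz ↦ (hasDerivAt_sineRemainder N
      (sin_pi_mul_pos (hx.trans_le hz.1) (hz.2.trans hy)).ne').hasDerivWithinAt)
    (fun z hz ↦ ?_) (convex_Icc x y) (Set.left_mem_Icc.2 hxy) (Set.right_mem_Icc.2 hxy)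
  · rwa [Real.norm_eq_abs, Real.norm_eq_abs, abs_of_nonneg (sub_nonneg.2 hxy)] at this
  · have h2 := two_mul_le_sin_pi_mul (hx.trans_le hz.1).le (hz.2.trans hy)
    rw [Real.norm_eq_abs, abs_div, abs_mul, abs_of_pos hp, abs_of_pos (a := Real.sin (Real.pi * z))
      (by linarith [hz.1])]
    apply div_le_div₀ hp.le _ (by positivity) (by linarith [hz.1])
    nlinarith [Real.abs_sin_le_one ((2 * N + 1) * (Real.pi * z))]

/-- Two steps of integration by parts applied to the Dirichlet kernel. -/
lemma abs_sineRemainder_add_le (N : ℕ) {y : ℝ} (h0 : 0 < y) (h1 : y ≤ 1 / 2) :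
    |sineRemainder N y + Real.cos ((2 * N + 1) * (Real.pi * y)) /
      ((2 * N + 1) * Real.sin (Real.pi * y))| ≤ 1 / ((2 * N + 1) ^ 2 * y ^ 2) := by
  have hp := Real.pi_pos
  have hp4 := Real.pi_le_four
  set a : ℝ := 2 * N + 1 with ha
  have hapos : 0 < a := by positivity
  set G : ℝ → ℝ := fun z ↦ sineRemainder N z
    + Real.cos (a * (Real.pi * z)) / (a * Real.sin (Real.pi * z))
    + Real.sin (a * (Real.pi * z)) * Real.cos (Real.pi * z) /
      (a ^ 2 * Real.sin (Real.pi * z) ^ 2) with hG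
  set G' : ℝ → ℝ := fun z ↦ - (Real.sin (a * (Real.pi * z)) * Real.pi *
    (Real.sin (Real.pi * z) ^ 2 + 2 * Real.cos (Real.pi * z) ^ 2)) /
      (a ^ 2 * Real.sin (Real.pi * z) ^ 3) with hG'
  have hderiv : ∀ z, 0 < z → z ≤ 1 / 2 → HasDerivAt G (G' z) z := by
    intro z hz hz'
    have hs := sin_pi_mul_pos hz hz'
    have e0 := hasDerivAt_sineRemainder N hs.ne'
    have e1 : HasDerivAt (fun z : ℝ ↦ Real.pi * z) Real.pi z := by
      simpa using (hasDerivAt_id z).const_mul Real.pi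
    have e2 : HasDerivAt (fun z : ℝ ↦ a * (Real.pi * z)) (a * Real.pi) z := e1.const_mul a
    have := (e0.add (e2.cos.div (e1.sin.const_mul a) (mul_pos hapos hs).ne')).add
      ((e2.sin.mul e1.cos).div ((e1.sin.pow 2).const_mul (a ^ 2))
        (mul_pos (pow_pos hapos 2) (pow_pos hs 2)).ne')
    refine this.congr_deriv ?_
    simp only [hG', Pi.mul_apply, Pi.pow_apply]
    rw [← ha]
    field_simp
    ring
  have hbound : ∀ z, 0 < z → z ≤ 1 / 2 → |G' z| ≤ 1 / (a ^ 2 * z ^ 3) := by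
    intro z hz hz'
    have hs := sin_pi_mul_pos hz hz'
    have hs2 := two_mul_le_sin_pi_mul hz.le hz'
    simp only [hG']
    rw [abs_div, abs_neg, abs_mul, abs_mul, abs_of_pos hp,
      abs_of_pos (a := a ^ 2 * Real.sin (Real.pi * z) ^ 3) (by positivity), abs_of_nonneg
      (a := Real.sin (Real.pi * z) ^ 2 + 2 * Real.cos (Real.pi * z) ^ 2) (by positivity)]
    have h3 : |Real.sin (a * (Real.pi * z))| * Real.pi *
        (Real.sin (Real.pi * z) ^ 2 + 2 * Real.cos (Real.pi * z) ^ 2) ≤ 8 := by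
      have i1 := Real.abs_sin_le_one (a * (Real.pi * z))
      have i2 : Real.sin (Real.pi * z) ^ 2 + 2 * Real.cos (Real.pi * z) ^ 2 ≤ 2 := by
        nlinarith [Real.sin_sq_add_cos_sq (Real.pi * z), sq_nonneg (Real.sin (Real.pi * z))]
      have i3 : |Real.sin (a * (Real.pi * z))| * Real.pi ≤ 4 := by nlinarith
      calc _ ≤ 4 * 2 := mul_le_mul i3 i2 (by positivity) (by norm_num)
        _ = 8 := by norm_num
    have h4 : (2 * z) ^ 3 ≤ Real.sin (Real.pi * z) ^ 3 := pow_le_pow_left₀ (by positivity) hs2 3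
    calc _ ≤ 8 / (a ^ 2 * (2 * z) ^ 3) :=
          div_le_div₀ (by norm_num) h3 (by positivity) (by gcongr)
      _ = 1 / (a ^ 2 * z ^ 3) := by field_simp; norm_num
  set φ : ℝ → ℝ := fun z ↦ 1 / (2 * a ^ 2 * z ^ 2) with hφ
  have hφd : ∀ z, 0 < z → HasDerivAt φ (-(1 / (a ^ 2 * z ^ 3))) z := by
    intro z hz
    have := ((hasDerivAt_pow 2 z).const_mul (2 * a ^ 2)).inv (by positivity)
    refine (this.congr_of_eventuallyEq ?_).congr_deriv ?_
    · filter_upwards with w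
      simp [hφ]
    · simp
      field_simp
  have hG0 : G (1 / 2) = 0 := by
    simp only [hG]
    rw [sineRemainder_half, cos_odd_mul_pi_div_two, show Real.pi * (1 / 2) = Real.pi / 2 by ring,
      Real.cos_pi_div_two]
    simp
  have hφ0 : 0 ≤ φ (1 / 2) := by simp only [hφ]; positivity
  have hl : ∀ z ∈ Set.Icc y (1 / 2), 0 < z := fun z hz ↦ h0.trans_le hz.1
  have hmem1 : y ∈ Set.Icc y (1 / 2) := Set.left_mem_Icc.2 h1
  have hmem2 : (1 / 2 : ℝ) ∈ Set.Icc y (1 / 2) := Set.right_mem_Icc.2 h1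
  have m1 : AntitoneOn (fun z ↦ G z + φ z) (Set.Icc y (1 / 2)) := by
    apply antitoneOn_of_hasDerivWithinAt_nonpos (convex_Icc _ _)
      (f' := fun z ↦ G' z + -(1 / (a ^ 2 * z ^ 3)))
    · exact fun z hz ↦ ((hderiv z (hl z hz) hz.2).add
        (hφd z (hl z hz))).continuousAt.continuousWithinAt
    · intro z hz
      have hz := interior_subset hz
      exact ((hderiv z (hl z hz) hz.2).add (hφd z (hl z hz))).hasDerivWithinAt
    · intro z hz
      have hz := interior_subset hz
      have := (abs_le.1 (hbound z (hl z hz) hz.2)).2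
      linarith
  have m2 : MonotoneOn (fun z ↦ G z - φ z) (Set.Icc y (1 / 2)) := by
    apply monotoneOn_of_hasDerivWithinAt_nonneg (convex_Icc _ _)
      (f' := fun z ↦ G' z - -(1 / (a ^ 2 * z ^ 3)))
    · exact fun z hz ↦ ((hderiv z (hl z hz) hz.2).sub
        (hφd z (hl z hz))).continuousAt.continuousWithinAt
    · intro z hz
      have hz := interior_subset hz
      exact ((hderiv z (hl z hz) hz.2).sub (hφd z (hl z hz))).hasDerivWithinAt
    · intro z hz
      have hz := interior_subset hz
      have := (abs_le.1 (hbound z (hl z hz) hz.2)).1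
      linarith
  have r1 := m1 hmem1 hmem2 h1
  have r2 := m2 hmem1 hmem2 h1
  simp only [hG0] at r1 r2
  have hs := sin_pi_mul_pos h0 h1
  have hs2 := two_mul_le_sin_pi_mul h0.le h1
  have r3 : |Real.sin (a * (Real.pi * y)) * Real.cos (Real.pi * y) /
      (a ^ 2 * Real.sin (Real.pi * y) ^ 2)| ≤ 1 / (a ^ 2 * (2 * y) ^ 2) := by
    rw [abs_div, abs_of_pos (a := a ^ 2 * Real.sin (Real.pi * y) ^ 2) (by positivity)]
    apply div_le_div₀ zero_le_one _ (by positivity) (by gcongr)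
    rw [abs_mul]
    exact mul_le_one₀ (Real.abs_sin_le_one _) (abs_nonneg _) (Real.abs_cos_le_one _)
  have r4 : φ y = 1 / 2 * (1 / (a ^ 2 * y ^ 2)) := by simp only [hφ]; field_simp
  have r5 : 1 / (a ^ 2 * (2 * y) ^ 2) = 1 / 4 * (1 / (a ^ 2 * y ^ 2)) := by field_simp; norm_num
  have r6 : 0 ≤ 1 / (a ^ 2 * y ^ 2) := by positivity
  have r7 : sineRemainder N y + Real.cos (a * (Real.pi * y)) / (a * Real.sin (Real.pi * y))
    = G y - Real.sin (a * (Real.pi * y)) * Real.cos (Real.pi * y) /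
      (a ^ 2 * Real.sin (Real.pi * y) ^ 2) := by simp only [hG]; ring
  rw [r7]
  rw [abs_le] at r3 ⊢
  constructor <;> linarith

/-- The distance of `log_k (X + σ r)` to `log_k X`, for a sign `σ`. -/
noncomputable def windowPoint (k : ℕ) (σ X : ℝ) (r : ℕ) : ℝ :=
  σ * Real.log ((X + σ * r) / X) / Real.log k

/-- `X + σ r` lies within a factor `√k` of `X`. -/
structure InWindow (k : ℕ) (σ X : ℝ) (r : ℕ) : Prop where
  pos : 0 < X + σ * r
  lower : X ^ 2 ≤ k * (X + σ * r) ^ 2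
  upper : (X + σ * r) ^ 2 ≤ k * X ^ 2

section Window

variable {k : ℕ} {σ X : ℝ} {r : ℕ}

lemma one_half_lt_log_of_two_le (hk : 2 ≤ k) : 1 / 2 < Real.log k := by
  have h := Real.log_two_gt_d9
  have : Real.log 2 ≤ Real.log k := Real.log_le_log (by norm_num) (by exact_mod_cast hk)
  linarith

lemma windowPoint_le_half (hk : 2 ≤ k) (hσ : σ = 1 ∨ σ = -1) (hX : 0 < X)
    (h : InWindow k σ X r) : windowPoint k σ X r ≤ 1 / 2 := by
  have hκ := one_half_lt_log_of_two_le hk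
  have hk0 : (0 : ℝ) < k := by positivity
  have hm := h.pos
  have h1 := Real.log_le_log (by positivity) h.lower
  have h2 := Real.log_le_log (by positivity) h.upper
  rw [Real.log_mul (by positivity) (by positivity), Real.log_pow, Real.log_pow] at h1 h2
  push_cast at h1 h2
  rw [windowPoint, div_le_iff₀ (by linarith), Real.log_div hm.ne' hX.ne']
  rcases hσ with rfl | rfl <;> linarith

lemma le_windowPoint (hk : 2 ≤ k) (hσ : σ = 1 ∨ σ = -1) (hX : 0 < X)
    (h : InWindow k σ X r) : r / (k * Real.log k * X) ≤ windowPoint k σ X r := by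
  have hκ := one_half_lt_log_of_two_le hk
  have hk2 : (2 : ℝ) ≤ k := by exact_mod_cast hk
  have hm := h.pos
  have hκ0 : 0 < Real.log k := by linarith
  rw [windowPoint, show (r : ℝ) / (k * Real.log k * X) = (r / (k * X)) / Real.log k by field_simp]
  gcongr
  rcases hσ with rfl | rfl
  · have h1 := Real.one_sub_inv_le_log_of_pos (x := (X + 1 * r) / X) (by positivity)
    rw [one_mul]
    refine le_trans ?_ h1
    have h2 : X + 1 * r ≤ k * X := by
      refine (pow_le_pow_iff_left₀ hm.le (by positivity) two_ne_zero).1 ?_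
      refine h.upper.trans ?_
      rw [mul_pow]
      gcongr
      nlinarith
    rw [inv_div, one_sub_div hm.ne', div_le_div_iff₀ (by positivity) hm]
    have : (r : ℝ) * (X + 1 * r) ≤ r * (k * X) := by gcongr
    linarith
  · have h1 := Real.log_le_sub_one_of_pos (x := (X + -1 * r) / X) (by positivity)
    have h2 : (r : ℝ) / (k * X) ≤ r / X := by
      apply div_le_div_of_nonneg_left (by positivity) hX
      nlinarith
    have h3 : (X + -1 * r) / X - 1 = - (r / X) := by field_simp; ring
    linarith

lemma windowPoint_pos (hk : 2 ≤ k) (hσ : σ = 1 ∨ σ = -1) (hX : 0 < X) (hr : 1 ≤ r)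
    (h : InWindow k σ X r) : 0 < windowPoint k σ X r := by
  have hκ := one_half_lt_log_of_two_le hk
  refine lt_of_lt_of_le ?_ (le_windowPoint hk hσ hX h)
  have : (0 : ℝ) < r := by exact_mod_cast hr
  have : (0 : ℝ) < k := by positivity
  have : 0 < Real.log k := by linarith
  positivity

lemma windowPoint_mono (hk : 2 ≤ k) (hσ : σ = 1 ∨ σ = -1) (hX : 0 < X) {r' : ℕ} (hr : r ≤ r')
    (h : 0 < X + σ * r) (h' : 0 < X + σ * r') : windowPoint k σ X r ≤ windowPoint k σ X r' := by
  have hκ := one_half_lt_log_of_two_le hk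
  have hr' : (r : ℝ) ≤ r' := by exact_mod_cast hr
  rw [windowPoint, windowPoint]
  refine div_le_div_of_nonneg_right ?_ (by linarith)
  rcases hσ with rfl | rfl
  · gcongr
  · have := Real.log_le_log (x := (X + -1 * r') / X) (y := (X + -1 * r) / X) (by positivity)
      (div_le_div_of_nonneg_right (by linarith) hX.le)
    linarith

/-- Trivial bound for the remainder, from its leading term. -/
lemma abs_sineRemainder_le (N : ℕ) {y : ℝ} (h0 : 0 < y) (h1 : y ≤ 1 / 2) :
    |sineRemainder N y| ≤ 1 / ((2 * N + 1) * (2 * y)) + 1 / ((2 * N + 1) ^ 2 * y ^ 2) := by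
  have h2 := abs_sineRemainder_add_le N h0 h1
  have h3 := two_mul_le_sin_pi_mul h0.le h1
  have h4 : |Real.cos ((2 * N + 1) * (Real.pi * y)) / ((2 * N + 1) * Real.sin (Real.pi * y))|
      ≤ 1 / ((2 * N + 1) * (2 * y)) := by
    have hs := sin_pi_mul_pos h0 h1
    rw [abs_div, abs_of_pos (a := (2 * (N : ℝ) + 1) * Real.sin (Real.pi * y)) (by positivity)]
    exact div_le_div₀ zero_le_one (Real.abs_cos_le_one _) (by positivity) (by gcongr)
  rw [abs_le] at h2 h4 ⊢
  constructor <;> linarith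

/-- The phase of the leading term of the remainder along a window. -/
noncomputable def windowPhase (k N : ℕ) (σ X : ℝ) (r : ℕ) : ℝ :=
  (2 * N + 1) / (2 * Real.log k) * Real.log ((X + σ * r) / X)

lemma cos_windowPoint (N : ℕ) (hσ : σ = 1 ∨ σ = -1) :
    Real.cos ((2 * N + 1) * (Real.pi * windowPoint k σ X r))
      = (expTurn (windowPhase k N σ X r)).re := by
  rw [expTurn_re, windowPhase, windowPoint]
  rcases hσ with rfl | rfl
  · congr 1
    field_simp
  · rw [← Real.cos_neg]
    congr 1
    field_simp

lemma windowPhase_gap (N : ℕ) (hσ : σ = 1 ∨ σ = -1) (hX : 0 < X)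
    (h : 1 < X + σ * (r + 1 : ℕ)) :
    (windowPhase k N σ X (r + 1) - windowPhase k N σ X r)
      - (windowPhase k N σ X (r + 2) - windowPhase k N σ X (r + 1))
      = (2 * N + 1) / (2 * Real.log k) * -Real.log (1 - 1 / (X + σ * (r + 1 : ℕ)) ^ 2) := by
  have h0 : 0 < X + σ * r := by
    rcases hσ with rfl | rfl <;> push_cast at h <;> linarith
  have h2 : 0 < X + σ * (r + 2 : ℕ) := by
    rcases hσ with rfl | rfl <;> push_cast at h ⊢ <;> linarith
  have hp : 1 - 1 / (X + σ * (r + 1 : ℕ)) ^ 2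
      = (X + σ * r) * (X + σ * (r + 2 : ℕ)) / (X + σ * (r + 1 : ℕ)) ^ 2 := by
    rw [eq_div_iff (by positivity), sub_mul, one_div_mul_cancel (by positivity)]
    push_cast
    rcases hσ with rfl | rfl <;> ring
  have h1 : 0 < X + σ * (r + 1 : ℕ) := by linarith
  rw [hp, Real.log_div (by positivity) (by positivity), Real.log_mul h0.ne' h2.ne', Real.log_pow,
    windowPhase, windowPhase, windowPhase, Real.log_div h0.ne' hX.ne', Real.log_div h1.ne' hX.ne',
    Real.log_div h2.ne' hX.ne']
  push_cast
  ring

lemma neg_log_one_sub_le {u : ℝ} (h0 : 0 ≤ u) (h1 : u ≤ 1 / 2) : -Real.log (1 - u) ≤ 2 * u := by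
  have h := Real.one_sub_inv_le_log_of_pos (x := 1 - u) (by linarith)
  have : (1 - u)⁻¹ ≤ 1 + 2 * u := by
    rw [inv_le_iff_one_le_mul₀ (by linarith)]
    nlinarith
  linarith

lemma le_neg_log_one_sub {u : ℝ} (h1 : u < 1) : u ≤ -Real.log (1 - u) := by
  have h := Real.log_le_sub_one_of_pos (x := 1 - u) (by linarith)
  linarith

lemma InWindow.two_le_sq (hk : 2 ≤ k) (hX : (k : ℝ) ≤ X) (h : InWindow k σ X r) :
    2 ≤ (X + σ * r) ^ 2 := by
  have hk2 : (2 : ℝ) ≤ k := by exact_mod_cast hk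
  have h1 := h.lower
  have h2 : (k : ℝ) * 2 ≤ k * (X + σ * r) ^ 2 := by nlinarith
  exact le_of_mul_le_mul_left h2 (by linarith)

lemma InWindow.one_lt (hk : 2 ≤ k) (hX : (k : ℝ) ≤ X) (h : InWindow k σ X r) :
    1 < X + σ * r := by
  nlinarith [h.two_le_sq hk hX, h.pos]

lemma norm_sum_expTurn_windowPhase_le {N A B : ℕ} (hk : 2 ≤ k) (hσ : σ = 1 ∨ σ = -1)
    (hX : (k : ℝ) ≤ X) (hN : 1 ≤ N) (hNX : (N : ℝ) ≤ X ^ 2)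
    (hw : ∀ r, A ≤ r → r < B → InWindow k σ X r) :
    ‖∑ r ∈ Finset.Ico A B, expTurn (windowPhase k N σ X r)‖
      ≤ (3 * N * k * B / (Real.log k * X ^ 2) + 2) * (10 * k * X / √N) := by
  have hκ := one_half_lt_log_of_two_le hk
  have hκ0 : 0 < Real.log k := by linarith
  have hk2 : (2 : ℝ) ≤ k := by exact_mod_cast hk
  have hN1 : (1 : ℝ) ≤ N := by exact_mod_cast hN
  have hX0 : 0 < X := by linarith
  have hκk : Real.log k ≤ k := (Real.log_le_sub_one_of_pos (by linarith)).trans (by linarith)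
  set δ : ℝ := N / (Real.log k * k * X ^ 2) with hδ
  set μ : ℝ := 3 * N * k / (Real.log k * X ^ 2) with hμ
  have hδ0 : 0 < δ := by positivity
  have hinv : ∀ r, A ≤ r → r + 1 < B → 1 / (k * X ^ 2) ≤ 1 / (X + σ * (r + 1 : ℕ)) ^ 2 ∧
      1 / (X + σ * (r + 1 : ℕ)) ^ 2 ≤ k / X ^ 2 ∧ 1 / (X + σ * (r + 1 : ℕ)) ^ 2 ≤ 1 / 2 := by
    intro r hr hr'
    have hin := hw (r + 1) (by omega) hr'
    have hpos := hin.pos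
    refine ⟨one_div_le_one_div_of_le (by positivity) hin.upper, ?_,
      one_div_le_one_div_of_le (by norm_num) (hin.two_le_sq hk hX)⟩
    rw [div_le_div_iff₀ (by positivity) (by positivity)]
    linarith [hin.lower]
  have hvdc := van_der_corput (F := windowPhase k N σ X) (a := A) (b := B) (δ := δ) (μ := μ) hδ0
    (by positivity) ?_ ?_
  · have hs : 0 < √(N : ℝ) := Real.sqrt_pos.2 (by linarith)
    have h1 : 1 / √δ ≤ k * X / √N := by
      rw [← Real.sqrt_one, ← Real.sqrt_div zero_le_one, hδ, one_div_div,
        Real.sqrt_div (by positivity)]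
      gcongr
      rw [Real.sqrt_le_left (by positivity)]
      have : Real.log k * k * X ^ 2 ≤ k * k * X ^ 2 := by gcongr
      linarith
    have h2 : 1 ≤ k * X / √N := by
      rw [one_le_div hs, Real.sqrt_le_left (by positivity)]
      rw [mul_pow]
      nlinarith [mul_nonneg (sub_nonneg.2 hk2) (sq_nonneg X), sq_nonneg X,
        mul_nonneg (mul_nonneg (sub_nonneg.2 hk2) (by linarith : (0 : ℝ) ≤ k)) (sq_nonneg X)]
    calc _ ≤ _ := hvdc
      _ = (3 * N * k * B / (Real.log k * X ^ 2) + 2) * (5 * (1 / √δ + 1)) := by rw [hμ]; ring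
      _ ≤ (3 * N * k * B / (Real.log k * X ^ 2) + 2) * (10 * k * X / √N) := by
        gcongr
        have : 10 * k * X / √N = 10 * (k * X / √N) := by ring
        linarith
  · intro r hr hr'
    obtain ⟨i1, i2, i3⟩ := hinv r hr hr'
    rw [windowPhase_gap N hσ hX0 ((hw (r + 1) (by omega) hr').one_lt hk hX)]
    calc δ ≤ (2 * N + 1) / (2 * Real.log k) * (1 / (k * X ^ 2)) := by
          rw [hδ, div_mul_div_comm, div_le_div_iff₀ (by positivity) (by positivity)]
          have : 0 < Real.log k * k * X ^ 2 := by positivity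
          nlinarith
      _ ≤ _ := by
          gcongr
          exact i1.trans (le_neg_log_one_sub (by linarith))
  · intro r hr hr'
    obtain ⟨i1, i2, i3⟩ := hinv r hr hr'
    rw [windowPhase_gap N hσ hX0 ((hw (r + 1) (by omega) hr').one_lt hk hX)]
    calc _ ≤ (2 * N + 1) / (2 * Real.log k) * (2 * (k / X ^ 2)) := by
          gcongr
          exact (neg_log_one_sub_le (by positivity) i3).trans (by linarith)
      _ = (2 * N + 1) * (k / (Real.log k * X ^ 2)) := by field_simp
      _ ≤ (3 * N) * (k / (Real.log k * X ^ 2)) := by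
          gcongr
          linarith
      _ = μ := by rw [hμ]; ring

lemma sum_one_div_sq_le {A : ℕ} (hA : 1 ≤ A) (B : ℕ) :
    ∑ r ∈ Finset.Ico A B, 1 / (r : ℝ) ^ 2 ≤ (2 : ℝ) / A := by
  rcases le_or_gt B A with h | h
  · rw [Finset.Ico_eq_empty_of_le h, Finset.sum_empty]
    positivity
  suffices ∑ r ∈ Finset.Ico A B, 1 / (r : ℝ) ^ 2 ≤ (2 : ℝ) / A - (2 : ℝ) / B by
    have : (0 : ℝ) ≤ 2 / B := by positivity
    linarith
  have hAB := h.le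
  clear h
  induction B, hAB using Nat.le_induction with
  | base => simp
  | succ B hB ih =>
    have hB' : (1 : ℝ) ≤ B := by exact_mod_cast hA.trans hB
    rw [Finset.sum_Ico_succ_top hB]
    have : 1 / (B : ℝ) ^ 2 ≤ (2 : ℝ) / B - (2 : ℝ) / (B + 1 : ℕ) := by
      push_cast
      rw [div_sub_div _ _ (by positivity) (by positivity), div_le_div_iff₀ (by positivity)
        (by positivity)]
      nlinarith
    linarith

end Window

section WindowSum

variable {k : ℕ} {σ X : ℝ}

lemma log_natCast_le (hk : 2 ≤ k) : Real.log k ≤ k :=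
  (Real.log_le_sub_one_of_pos (by positivity)).trans (by linarith)

lemma abs_sum_sineRemainder_le_of_partial_sums {N A B : ℕ} {U : ℝ} (hk : 2 ≤ k)
    (hσ : σ = 1 ∨ σ = -1) (hX : 0 < X) (hN : 1 ≤ N) (hA : 1 ≤ A) (hU : 0 ≤ U)
    (hw : ∀ r, A ≤ r → r < B → InWindow k σ X r)
    (hG : ∀ c, A ≤ c → c ≤ B →
      ‖∑ r ∈ Finset.Ico A c, expTurn (windowPhase k N σ X r)‖ ≤ U) :
    |∑ r ∈ Finset.Ico A B, sineRemainder N (windowPoint k σ X r)|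
      ≤ k * Real.log k * X / (N * A) * U + k ^ 4 * X ^ 2 / (N ^ 2 * A) := by
  have hκ := one_half_lt_log_of_two_le hk
  have hκ0 : 0 < Real.log k := by linarith
  have hk2 : (2 : ℝ) ≤ k := by exact_mod_cast hk
  have hN1 : (1 : ℝ) ≤ N := by exact_mod_cast hN
  have hA1 : (1 : ℝ) ≤ A := by exact_mod_cast hA
  have hκk := log_natCast_le hk
  set y := windowPoint k σ X with hy
  set h : ℕ → ℝ := fun r ↦ 1 / ((2 * N + 1) * Real.sin (Real.pi * y r)) with hh
  have hy0 : ∀ r, A ≤ r → r < B → 0 < y r := fun r hr hr' ↦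
    windowPoint_pos hk hσ hX (hA.trans hr) (hw r hr hr')
  have hyh : ∀ r, A ≤ r → r < B → y r ≤ 1 / 2 := fun r hr hr' ↦
    windowPoint_le_half hk hσ hX (hw r hr hr')
  have hyl : ∀ r, A ≤ r → r < B → r / (k * Real.log k * X) ≤ y r := fun r hr hr' ↦
    le_windowPoint hk hσ hX (hw r hr hr')
  have hmain := norm_sum_mul_le_of_partial_sums (v := fun r ↦ expTurn (windowPhase k N σ X r))
    (h := h) (a := A) (b := B) (B := k * Real.log k * X / (4 * N * A)) hU (by positivity) hG ?_ ?_
  · have hre := (abs_re_le_norm _).trans hmain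
    rw [re_sum] at hre
    have herr : |∑ r ∈ Finset.Ico A B, (sineRemainder N (y r) + ((h r : ℂ) *
        expTurn (windowPhase k N σ X r)).re)| ≤ k ^ 4 * X ^ 2 / (N ^ 2 * A) := by
      refine (Finset.abs_sum_le_sum_abs _ _).trans ?_
      calc _ ≤ ∑ r ∈ Finset.Ico A B, k ^ 4 * X ^ 2 / (2 * N ^ 2) * (1 / (r : ℝ) ^ 2) := by
            refine Finset.sum_le_sum fun r hr ↦ ?_
            obtain ⟨hr, hr'⟩ := Finset.mem_Ico.1 hr
            have hr0 : (0 : ℝ) < r := by exact_mod_cast hA.trans hr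
            have h1 := abs_sineRemainder_add_le N (hy0 r hr hr') (hyh r hr hr')
            rw [cos_windowPoint N hσ] at h1
            rw [re_ofReal_mul, hh]
            simp only
            rw [one_div_mul_eq_div]
            refine h1.trans ?_
            calc 1 / ((2 * (N : ℝ) + 1) ^ 2 * y r ^ 2)
                ≤ 1 / ((2 * N) ^ 2 * (r / (k * Real.log k * X)) ^ 2) := by
                  have := hyl r hr hr'
                  gcongr
                  linarith
              _ = (k * Real.log k) ^ 2 * X ^ 2 / (4 * N ^ 2) * (1 / (r : ℝ) ^ 2) := by
                  field_simp
                  norm_num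
              _ ≤ (k * k) ^ 2 * X ^ 2 / (2 * N ^ 2) * (1 / (r : ℝ) ^ 2) := by
                  gcongr
                  norm_num
              _ = _ := by ring
        _ ≤ k ^ 4 * X ^ 2 / (2 * N ^ 2) * (2 / A) := by
            rw [← Finset.mul_sum]
            gcongr
            exact sum_one_div_sq_le hA B
        _ = _ := by field_simp
    rw [Finset.sum_add_distrib] at herr
    have hc : 4 * (k * Real.log k * X / (4 * N * A)) * U = k * Real.log k * X / (N * A) * U := by
      field_simp
    rw [hc] at hre
    rw [abs_le] at hre herr ⊢
    constructor <;> linarith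
  · intro r hr hr'
    have hs := sin_pi_mul_pos (hy0 r hr (by omega)) (hyh r hr (by omega))
    simp only [hh]
    gcongr
    apply Real.sin_le_sin_of_le_of_le_pi_div_two
    · have := hy0 r hr (by omega)
      nlinarith [Real.pi_pos]
    · have := hyh (r + 1) (by omega) hr'
      nlinarith [Real.pi_pos]
    · have := windowPoint_mono hk hσ hX (Nat.le_succ r) (hw r hr (by omega)).pos
        (hw (r + 1) (by omega) hr').pos
      have := Real.pi_pos
      gcongr
  · intro r hr hr'
    have hs := sin_pi_mul_pos (hy0 r hr hr') (hyh r hr hr')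
    have hs2 := two_mul_le_sin_pi_mul (hy0 r hr hr').le (hyh r hr hr')
    simp only [hh]
    rw [abs_of_pos (by positivity)]
    have hr1 : (A : ℝ) ≤ r := by exact_mod_cast hr
    have h1 : 2 * (A / (k * Real.log k * X)) ≤ Real.sin (Real.pi * y r) := by
      have : (A : ℝ) / (k * Real.log k * X) ≤ r / (k * Real.log k * X) := by gcongr
      have := hyl r hr hr'
      linarith
    calc _ ≤ 1 / ((2 * N) * (2 * (A / (k * Real.log k * X)))) := by
          gcongr
          linarith
      _ = _ := by field_simp; norm_num

lemma abs_sum_sineRemainder_window_le {N A B : ℕ} (hk : 2 ≤ k)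
    (hσ : σ = 1 ∨ σ = -1) (hX : (k : ℝ) ≤ X) (hN : 1 ≤ N) (hNX : (N : ℝ) ≤ X ^ 2) (hA : 1 ≤ A)
    (hw : ∀ r, A ≤ r → r < B → InWindow k σ X r) :
    |∑ r ∈ Finset.Ico A B, sineRemainder N (windowPoint k σ X r)|
      ≤ 30 * k ^ 4 * (B / (A * √N) + X ^ 2 / (A * (N * √N))) := by
  have hκ := one_half_lt_log_of_two_le hk
  have hκ0 : 0 < Real.log k := by linarith
  have hk2 : (2 : ℝ) ≤ k := by exact_mod_cast hk
  have hN1 : (1 : ℝ) ≤ N := by exact_mod_cast hN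
  have hA1 : (1 : ℝ) ≤ A := by exact_mod_cast hA
  have hX0 : 0 < X := by linarith
  have hκk := log_natCast_le hk
  have hs : 0 < √(N : ℝ) := Real.sqrt_pos.2 (by linarith)
  have hsN : √(N : ℝ) ≤ N := by
    rw [Real.sqrt_le_left (by linarith)]
    nlinarith
  refine (abs_sum_sineRemainder_le_of_partial_sums hk hσ hX0 hN hA
    (U := (3 * N * k * B / (Real.log k * X ^ 2) + 2) * (10 * k * X / √N)) (by positivity) hw
    fun c hc hc' ↦ ?_).trans ?_
  · refine (norm_sum_expTurn_windowPhase_le (B := c) hk hσ hX hN hNX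
      fun r hr hr' ↦ hw r hr (hr'.trans_le hc')).trans ?_
    gcongr
  · have e1 : k * Real.log k * X / (N * A) *
        ((3 * N * k * B / (Real.log k * X ^ 2) + 2) * (10 * k * X / √N))
        = 30 * k ^ 3 * (B / (A * √N)) + 20 * (k ^ 2 * Real.log k) * (X ^ 2 / (A * (N * √N))) := by
      field_simp
      ring
    have e2 : (k : ℝ) ^ 4 * X ^ 2 / (N ^ 2 * A) ≤ k ^ 4 * (X ^ 2 / (A * (N * √N))) := by
      rw [mul_div_assoc]
      have : (A : ℝ) * (N * √N) ≤ N ^ 2 * A := by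
        have := mul_le_mul_of_nonneg_left hsN (by positivity : (0 : ℝ) ≤ A * N)
        linarith
      gcongr
    have e3 : (k : ℝ) ^ 3 ≤ k ^ 4 := pow_le_pow_right₀ (by linarith) (by norm_num)
    have e4 : (k : ℝ) ^ 2 * Real.log k ≤ k ^ 4 := by
      calc (k : ℝ) ^ 2 * Real.log k ≤ (k : ℝ) ^ 2 * k := by gcongr
        _ = (k : ℝ) ^ 3 := by ring
        _ ≤ _ := e3
    have p1 : 0 ≤ (B : ℝ) / (A * √N) := by positivity
    have p2 : 0 ≤ X ^ 2 / (A * (N * √N)) := by positivity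
    have q1 := mul_le_mul_of_nonneg_right e3 p1
    have q2 := mul_le_mul_of_nonneg_right e4 p2
    have q3 : 0 ≤ (k : ℝ) ^ 4 * (X ^ 2 / (A * (N * √N))) := by positivity
    rw [e1]
    linarith

end WindowSum

section WindowPair

variable {k : ℕ} {X : ℝ}

lemma abs_sineRemainder_pair_le {N r : ℕ} (hk : 2 ≤ k) (hX : 0 < X) (hr : 1 ≤ r)
    (hrX : (r : ℝ) ≤ X / 2) (hp : InWindow k 1 X r) (hm : InWindow k (-1) X r) :
    |sineRemainder N (windowPoint k 1 X r) - sineRemainder N (windowPoint k (-1) X r)|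
      ≤ 4 * k * (r / X) := by
  have hκ := one_half_lt_log_of_two_le hk
  have hκ0 : 0 < Real.log k := by linarith
  have hr0 : (0 : ℝ) < r := by exact_mod_cast hr
  have h0 := windowPoint_pos hk (Or.inl rfl) hX hr hp
  have hl := le_windowPoint hk (Or.inl rfl) hX hp
  have h1 := windowPoint_le_half hk (Or.inr rfl) hX hm
  have hdiff : windowPoint k (-1) X r - windowPoint k 1 X r
      = -Real.log (1 - (r / X) ^ 2) / Real.log k := by
    have hpp := hp.pos
    have hmp := hm.pos
    rw [show 1 - (r / X) ^ 2 = ((X + 1 * r) / X) * ((X + -1 * r) / X) by field_simp; ring,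
      Real.log_mul (by positivity) (by positivity), windowPoint, windowPoint]
    ring
  have hu : (r / X) ^ 2 ≤ 1 / 2 := by
    have : r / X ≤ 1 / 2 := by
      rw [div_le_iff₀ hX]
      linarith
    nlinarith [show 0 ≤ r / X by positivity]
  have hle : windowPoint k 1 X r ≤ windowPoint k (-1) X r := by
    rw [← sub_nonneg, hdiff]
    have := le_neg_log_one_sub (u := (r / X) ^ 2) (by linarith)
    have : 0 ≤ (r / X) ^ 2 := by positivity
    apply div_nonneg <;> linarith
  have h2 := abs_sineRemainder_sub_le N h0 hle h1
  rw [abs_sub_comm] at h2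
  refine h2.trans ?_
  rw [hdiff]
  have hk0 : (0 : ℝ) < k := by positivity
  calc _ ≤ 4 / (2 * (r / (k * Real.log k * X))) * (2 * (r / X) ^ 2 / Real.log k) := by
        have := neg_log_one_sub_le (u := (r / X) ^ 2) (by positivity) hu
        have := Real.pi_le_four
        have : 0 ≤ -Real.log (1 - (r / X) ^ 2) :=
          le_trans (by positivity) (le_neg_log_one_sub (u := (r / X) ^ 2) (by linarith))
        gcongr
    _ = _ := by field_simp

lemma abs_window_sub_window_le {N B₁ B₂ : ℕ} {q : ℝ} (hk : 2 ≤ k) (hX : (k : ℝ) ≤ X)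
    (hq : 4 ≤ q) (hqN : q ^ 4 = N) (hNX : (N : ℝ) ≤ X ^ 2)
    (hp : ∀ r, 1 ≤ r → r < B₁ → InWindow k 1 X r)
    (hm : ∀ r, 1 ≤ r → r < B₂ → InWindow k (-1) X r)
    (h1 : X ≤ 4 * B₁) (h2 : X ≤ 4 * B₂) (h1' : B₁ ≤ k * X) (h2' : B₂ ≤ k * X) :
    |∑ r ∈ Finset.Ico 1 B₁, sineRemainder N (windowPoint k 1 X r)
      - ∑ r ∈ Finset.Ico 1 B₂, sineRemainder N (windowPoint k (-1) X r)|
      ≤ 1000 * k ^ 5 * (1 / q + X / N) := by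
  have hk2 : (2 : ℝ) ≤ k := by exact_mod_cast hk
  have hX0 : 0 < X := by linarith
  have hq0 : 0 < q := by linarith
  have hN0 : (0 : ℝ) < N := by rw [← hqN]; positivity
  have hN1 : 1 ≤ N := by
    have : 0 < N := by exact_mod_cast hN0
    omega
  have hsqrt : √(N : ℝ) = q ^ 2 := by
    rw [← hqN, show q ^ 4 = (q ^ 2) ^ 2 by ring, Real.sqrt_sq (by positivity)]
  have hqX : q ^ 2 ≤ X := by
    apply (pow_le_pow_iff_left₀ (by positivity) hX0.le two_ne_zero).1
    rw [← pow_mul, hqN]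
    exact hNX
  have hq4 : 4 * q ≤ q ^ 2 := by nlinarith
  set A₀ := ⌊X / (4 * q ^ 2)⌋₊ + 1 with hA₀
  set A₁ := ⌊X / (4 * q)⌋₊ + 1 with hA₁
  have a01 : A₀ ≤ A₁ := by
    rw [hA₀, hA₁]
    gcongr
    nlinarith
  have l0 : X / (4 * q ^ 2) ≤ A₀ := by
    rw [hA₀]
    push_cast
    exact (Nat.lt_floor_add_one _).le
  have l1 : X / (4 * q) ≤ A₁ := by
    rw [hA₁]
    push_cast
    exact (Nat.lt_floor_add_one _).le
  have u0 : (A₀ : ℝ) ≤ 2 * (X / q ^ 2) := by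
    have e1 : (⌊X / (4 * q ^ 2)⌋₊ : ℝ) ≤ X / (4 * q ^ 2) := Nat.floor_le (by positivity)
    have e2 : X / (4 * q ^ 2) ≤ X / q ^ 2 := by
      gcongr
      nlinarith [sq_nonneg q]
    have e3 : 1 ≤ X / q ^ 2 := by rwa [one_le_div (by positivity)]
    rw [hA₀]
    push_cast
    linarith
  have u1 : (A₁ : ℝ) ≤ X / (2 * q) := by
    have e1 : (⌊X / (4 * q)⌋₊ : ℝ) ≤ X / (4 * q) := Nat.floor_le (by positivity)
    have e3 : 1 ≤ X / (4 * q) := by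
      rw [one_le_div (by positivity)]
      linarith
    have e4 : X / (2 * q) = X / (4 * q) + X / (4 * q) := by field_simp; norm_num
    rw [hA₁]
    push_cast
    linarith
  have u1' : (A₁ : ℝ) ≤ X / 8 := by
    refine u1.trans ?_
    gcongr
    linarith
  have b1 : A₁ ≤ B₁ := by
    have : (A₁ : ℝ) ≤ B₁ := by linarith
    exact_mod_cast this
  have b2 : A₁ ≤ B₂ := by
    have : (A₁ : ℝ) ≤ B₂ := by linarith
    exact_mod_cast this
  have key : ∀ (σ : ℝ) (B : ℕ), (σ = 1 ∨ σ = -1) → A₁ ≤ B → (B : ℝ) ≤ k * X →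
      (∀ r, 1 ≤ r → r < B → InWindow k σ X r) →
      |∑ r ∈ Finset.Ico A₀ B, sineRemainder N (windowPoint k σ X r)|
        ≤ 240 * k ^ 5 * (1 / q + X / N) := by
    intro σ B hσ hB hB' hw
    have v1 := abs_sum_sineRemainder_window_le (A := A₀) (B := A₁) hk hσ hX hN1 hNX (by omega)
      (fun r hr hr' ↦ hw r (by omega) (by omega))
    have v2 := abs_sum_sineRemainder_window_le (A := A₁) (B := B) hk hσ hX hN1 hNX (by omega)
      (fun r hr hr' ↦ hw r (by omega) (by omega))
    rw [← Finset.sum_Ico_consecutive _ a01 hB]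
    refine (abs_add_le _ _).trans ((add_le_add v1 v2).trans ?_)
    rw [hsqrt]
    have w1 : (A₁ : ℝ) / (A₀ * q ^ 2) ≤ 2 / q := by
      calc _ ≤ (X / (2 * q)) / (X / (4 * q ^ 2) * q ^ 2) := by gcongr
        _ = _ := by field_simp; norm_num
    have w2 : X ^ 2 / (A₀ * (N * q ^ 2)) ≤ 4 * (X / N) := by
      calc _ ≤ X ^ 2 / (X / (4 * q ^ 2) * (N * q ^ 2)) := by gcongr
        _ = _ := by field_simp
    have w3 : (B : ℝ) / (A₁ * q ^ 2) ≤ 4 * k / q := by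
      calc _ ≤ (k * X) / (X / (4 * q) * q ^ 2) := by gcongr
        _ = _ := by field_simp
    have w4 : X ^ 2 / (A₁ * (N * q ^ 2)) ≤ 4 * (X / N) := by
      refine le_trans ?_ w2
      have : (A₀ : ℝ) ≤ A₁ := by exact_mod_cast a01
      gcongr
    calc _ ≤ 30 * (k : ℝ) ^ 4 * (2 / q + 4 * (X / N)) + 30 * k ^ 4 * (4 * k / q + 4 * (X / N)) := by
          gcongr
      _ = (60 * k ^ 4 + 120 * k ^ 5) * (1 / q) + 240 * k ^ 4 * (X / N) := by ring
      _ ≤ (240 * k ^ 5) * (1 / q) + 240 * k ^ 5 * (X / N) := by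
          have : (k : ℝ) ^ 4 ≤ k ^ 5 := pow_le_pow_right₀ (by linarith) (by norm_num)
          have : (0 : ℝ) ≤ k ^ 5 := by positivity
          gcongr
          linarith
      _ = _ := by ring
  have hpair : |∑ r ∈ Finset.Ico 1 A₀, (sineRemainder N (windowPoint k 1 X r)
      - sineRemainder N (windowPoint k (-1) X r))| ≤ 16 * k * (X / N) := by
    calc _ ≤ ∑ r ∈ Finset.Ico 1 A₀, 4 * k * (A₀ / X) := by
          refine (Finset.abs_sum_le_sum_abs _ _).trans (Finset.sum_le_sum fun r hr ↦ ?_)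
          obtain ⟨hr, hr'⟩ := Finset.mem_Ico.1 hr
          have hrA : (r : ℝ) ≤ A₀ := by exact_mod_cast hr'.le
          have hA01 : (A₀ : ℝ) ≤ A₁ := by exact_mod_cast a01
          refine (abs_sineRemainder_pair_le hk hX0 hr (by linarith) (hp r hr (by omega))
            (hm r hr (by omega))).trans ?_
          gcongr
      _ ≤ A₀ * (4 * k * (A₀ / X)) := by
          rw [Finset.sum_const, nsmul_eq_mul]
          gcongr
          simp
      _ ≤ (2 * (X / q ^ 2)) * (4 * k * ((2 * (X / q ^ 2)) / X)) := by gcongr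
      _ = _ := by
          rw [← hqN]
          field_simp
          norm_num
  have c1 := key 1 B₁ (Or.inl rfl) b1 h1' hp
  have c2 := key (-1) B₂ (Or.inr rfl) b2 h2' hm
  rw [← Finset.sum_Ico_consecutive _ (by omega : 1 ≤ A₀) (a01.trans b1),
    ← Finset.sum_Ico_consecutive _ (by omega : 1 ≤ A₀) (a01.trans b2)]
  rw [Finset.sum_sub_distrib] at hpair
  have hfin : 16 * k * (X / N) ≤ 500 * k ^ 5 * (1 / q + X / N) := by
    have e1 : (k : ℝ) ≤ k ^ 5 := le_self_pow₀ (by linarith) (by norm_num)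
    have e2 : 16 * k * (X / N) ≤ 16 * k ^ 5 * (X / N) := by gcongr
    have e3 : 0 ≤ (k : ℝ) ^ 5 * (X / N) := by positivity
    have e4 : 0 ≤ (k : ℝ) ^ 5 * (1 / q) := by positivity
    linarith
  rw [abs_le] at c1 c2 hpair ⊢
  constructor <;> linarith

lemma abs_window_le {N B : ℕ} {σ : ℝ} (hk : 2 ≤ k) (hσ : σ = 1 ∨ σ = -1) (hX : 1 ≤ X)
    (hN : 1 ≤ N) (hNX : X ≤ N) (hw : ∀ r, 1 ≤ r → r < B → InWindow k σ X r)
    (hB : B ≤ k * X) :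
    |∑ r ∈ Finset.Ico 1 B, sineRemainder N (windowPoint k σ X r)| ≤ k ^ 5 * (X ^ 2 / N) := by
  have hκ := one_half_lt_log_of_two_le hk
  have hκ0 : 0 < Real.log k := by linarith
  have hκk := log_natCast_le hk
  have hk2 : (2 : ℝ) ≤ k := by exact_mod_cast hk
  have hX0 : 0 < X := by linarith
  have hN1 : (1 : ℝ) ≤ N := by exact_mod_cast hN
  calc _ ≤ ∑ r ∈ Finset.Ico 1 B, (k : ℝ) ^ 4 * (X / N) := by
        refine (Finset.abs_sum_le_sum_abs _ _).trans (Finset.sum_le_sum fun r hr ↦ ?_)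
        obtain ⟨hr, hr'⟩ := Finset.mem_Ico.1 hr
        have hr1 : (1 : ℝ) ≤ r := by exact_mod_cast hr
        have h := hw r hr hr'
        have hl : 1 / (k ^ 2 * X) ≤ windowPoint k σ X r := by
          refine le_trans ?_ (le_windowPoint hk hσ hX0 h)
          gcongr
          rw [pow_two]
          gcongr
        refine (abs_sineRemainder_le N (windowPoint_pos hk hσ hX0 hr h)
          (windowPoint_le_half hk hσ hX0 h)).trans ?_
        calc _ ≤ 1 / ((2 * N) * (2 * (1 / (k ^ 2 * X)))) +
              1 / ((2 * N) ^ 2 * (1 / (k ^ 2 * X)) ^ 2) := by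
              gcongr <;> linarith
          _ = 1 / 4 * k ^ 2 * (X / N) + 1 / 4 * (k ^ 4 * (X / N) * (X / N)) := by
              field_simp
              ring
          _ ≤ 1 / 4 * k ^ 4 * (X / N) + 1 / 4 * (k ^ 4 * (X / N) * 1) := by
              have e1 : (k : ℝ) ^ 2 ≤ k ^ 4 := pow_le_pow_right₀ (by linarith) (by norm_num)
              have e2 : X / N ≤ 1 := by rwa [div_le_one (by linarith)]
              gcongr
          _ ≤ _ := by
              have : 0 ≤ (k : ℝ) ^ 4 * (X / N) := by positivity
              linarith
    _ ≤ (k * X) * ((k : ℝ) ^ 4 * (X / N)) := by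
        rw [Finset.sum_const, nsmul_eq_mul]
        gcongr
        refine le_trans ?_ hB
        simp
    _ = _ := by ring

end WindowPair

/-- One more than the number of integers in the right window of `X`. -/
def rightLength (k X : ℕ) : ℕ := Nat.sqrt (k * X ^ 2) - X + 1

/-- One more than the number of integers in the left window of `X`. -/
def leftLength (k X : ℕ) : ℕ := X - Nat.sqrt (X ^ 2 / k)

section WindowLengths

variable {k X : ℕ}

lemma le_sqrt_mul_sq (hk : 2 ≤ k) (X : ℕ) : X ≤ Nat.sqrt (k * X ^ 2) := by
  rw [Nat.le_sqrt']
  nlinarith [Nat.zero_le (X ^ 2)]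

lemma sqrt_sq_div_le (k X : ℕ) : Nat.sqrt (X ^ 2 / k) ≤ X := by
  calc _ ≤ Nat.sqrt (X ^ 2) := Nat.sqrt_le_sqrt (Nat.div_le_self _ _)
    _ = X := Nat.sqrt_eq' X

lemma inWindow_right (hk : 2 ≤ k) (hX : 1 ≤ X) {r : ℕ} (hr : r < rightLength k X) :
    InWindow k 1 X r := by
  have hX0 : (1 : ℝ) ≤ X := by exact_mod_cast hX
  have hk2 : (2 : ℝ) ≤ k := by exact_mod_cast hk
  have h1 : X + r ≤ Nat.sqrt (k * X ^ 2) := by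
    have := le_sqrt_mul_sq hk X
    rw [rightLength] at hr
    omega
  rw [Nat.le_sqrt'] at h1
  refine ⟨by positivity, ?_, ?_⟩
  · have : (0 : ℝ) ≤ r := by positivity
    nlinarith
  · rw [one_mul]
    exact_mod_cast h1

lemma inWindow_left (hk : 2 ≤ k) (hX : 1 ≤ X) {r : ℕ} (hr : r < leftLength k X) :
    InWindow k (-1) X r := by
  have hX0 : (1 : ℝ) ≤ X := by exact_mod_cast hX
  have hk2 : (2 : ℝ) ≤ k := by exact_mod_cast hk
  rw [leftLength] at hr
  obtain ⟨m, hm⟩ : ∃ m, X = r + m := Nat.exists_eq_add_of_le (by omega)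
  have h1 : Nat.sqrt (X ^ 2 / k) < m := by omega
  have hmr : (X : ℝ) + -1 * r = m := by
    rw [hm]
    push_cast
    ring
  rw [Nat.sqrt_lt', Nat.div_lt_iff_lt_mul (by omega)] at h1
  have hmX : (m : ℝ) ≤ X := by
    have : m ≤ X := by omega
    exact_mod_cast this
  have hm0 : 0 < m := by
    rcases Nat.eq_zero_or_pos m with h | h
    · simp [h] at h1
    · exact h
  refine ⟨?_, ?_, ?_⟩
  · rw [hmr]
    exact_mod_cast hm0
  · rw [hmr]
    have : (X : ℝ) ^ 2 ≤ m ^ 2 * k := by exact_mod_cast h1.le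
    linarith
  · rw [hmr]
    have : (m : ℝ) ^ 2 ≤ X ^ 2 := by gcongr
    nlinarith

lemma rightLength_le (hk : 2 ≤ k) (hX : 1 ≤ X) : (rightLength k X : ℝ) ≤ k * X := by
  have h : Nat.sqrt (k * X ^ 2) ≤ k * X := by
    calc _ ≤ Nat.sqrt ((k * X) ^ 2) := Nat.sqrt_le_sqrt (by
          rw [mul_pow]
          exact Nat.mul_le_mul_right _ (Nat.le_self_pow two_ne_zero k))
      _ = k * X := Nat.sqrt_eq' _
  have := le_sqrt_mul_sq hk X
  have : rightLength k X ≤ k * X := by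
    rw [rightLength]
    omega
  exact_mod_cast this

lemma leftLength_le (hk : 2 ≤ k) : (leftLength k X : ℝ) ≤ k * X := by
  have : leftLength k X ≤ k * X := by
    rw [leftLength]
    nlinarith [Nat.sub_le X (Nat.sqrt (X ^ 2 / k))]
  exact_mod_cast this

lemma le_rightLength (hk : 2 ≤ k) : (X : ℝ) ≤ 4 * rightLength k X := by
  have h := Nat.lt_succ_sqrt' (k * X ^ 2)
  have h2 := le_sqrt_mul_sq hk X
  have : X ≤ 4 * rightLength k X := by
    rw [rightLength]
    obtain ⟨t, ht⟩ := Nat.exists_eq_add_of_le h2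
    rw [ht] at h ⊢
    by_contra! hc
    have : 4 * (t + 1) ≤ X := by omega
    have : 2 * X ^ 2 ≤ k * X ^ 2 := by gcongr
    simp only [Nat.succ_eq_add_one] at h
    nlinarith
  exact_mod_cast this

lemma le_leftLength (hk : 2 ≤ k) : (X : ℝ) ≤ 4 * leftLength k X := by
  have h := Nat.sqrt_le' (X ^ 2 / k)
  have h2 := sqrt_sq_div_le k X
  have h3 : Nat.sqrt (X ^ 2 / k) ^ 2 * 2 ≤ X ^ 2 := by
    calc _ ≤ X ^ 2 / k * k := Nat.mul_le_mul h hk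
      _ ≤ X ^ 2 := Nat.div_mul_le_self _ _
  have : X ≤ 4 * leftLength k X := by
    rw [leftLength]
    obtain ⟨t, ht⟩ := Nat.exists_eq_add_of_le h2
    by_contra! hc
    have : 4 * t < X := by omega
    nlinarith
  exact_mod_cast this

/-- The left-hand remainder sum at the top of the range, by Kusmin–Landau. -/
lemma abs_top_window_le {N : ℕ} (hk : 2 ≤ k) (hN : 1 ≤ N) (hX1 : 100 * k * N ≤ X)
    (hX2 : X ≤ 100 * k ^ 2 * N) :
    |∑ r ∈ Finset.Ico 1 (leftLength k X), sineRemainder N (windowPoint k (-1) X r)|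
      ≤ 100000 * k ^ 8 := by
  have hκ := one_half_lt_log_of_two_le hk
  have hκ0 : 0 < Real.log k := by linarith
  have hκk := log_natCast_le hk
  have hk2 : (2 : ℝ) ≤ k := by exact_mod_cast hk
  have hN1 : (1 : ℝ) ≤ N := by exact_mod_cast hN
  have h1 : 100 * (k : ℝ) * N ≤ X := by exact_mod_cast hX1
  have h2 : (X : ℝ) ≤ 100 * k ^ 2 * N := by exact_mod_cast hX2
  have hkX : (k : ℝ) ≤ X := by nlinarith
  have hX1' : 1 ≤ X := by
    have : (1 : ℝ) ≤ X := by linarith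
    exact_mod_cast this
  have hX0 : (0 : ℝ) < X := by linarith
  have hw : ∀ r, 1 ≤ r → r < leftLength k X → InWindow k (-1) X r :=
    fun r _ hr ↦ inWindow_left hk hX1' hr
  have hd : ∀ r, 1 ≤ r → r < leftLength k X →
      windowPhase k N (-1) X (r + 1) - windowPhase k N (-1) X r
        = (2 * N + 1) / (2 * Real.log k) * Real.log (1 - 1 / (X + -1 * r)) := by
    intro r hr hr'
    have hm := (hw r hr hr').one_lt hk hkX
    have hm' : 0 < (X : ℝ) + -1 * (r + 1 : ℕ) := by push_cast; linarith
    have hm0 : 0 < (X : ℝ) + -1 * r := by linarith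
    rw [windowPhase, windowPhase, Real.log_div hm'.ne' hX0.ne', Real.log_div hm0.ne' hX0.ne',
      show 1 - 1 / ((X : ℝ) + -1 * r) = (X + -1 * (r + 1 : ℕ)) / (X + -1 * r) by
        rw [eq_div_iff hm0.ne', sub_mul, one_div_mul_cancel hm0.ne']
        push_cast
        ring, Real.log_div hm'.ne' hm0.ne']
    ring
  set θ : ℝ := 1 / (100 * k ^ 3) with hθ
  have hθ2 : θ ≤ 1 / 2 := by
    rw [hθ]
    gcongr
    nlinarith [pow_le_pow_left₀ (by norm_num) hk2 3]
  have hkl := fun c (hc : c ≤ leftLength k X) ↦ kusmin_landau (F := windowPhase k N (-1) X) (a := 1)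
    (b := c) (θ := θ) (ν := -1) (by positivity) ?_ ?_ ?_
  · refine (abs_sum_sineRemainder_le_of_partial_sums hk (Or.inr rfl) hX0 hN le_rfl
      (U := 3 / θ) (by positivity) hw fun c _ hc ↦ hkl c hc).trans ?_
    have e1 : (X : ℝ) / N ≤ 100 * k ^ 2 := by rwa [div_le_iff₀ (by linarith)]
    calc _ = k * Real.log k * (300 * k ^ 3) * (X / N) + k ^ 4 * (X / N) ^ 2 := by
          rw [hθ]
          push_cast
          field_simp
          ring
      _ ≤ k * k * (300 * k ^ 3) * (100 * k ^ 2) + k ^ 4 * (100 * k ^ 2) ^ 2 := by gcongr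
      _ = 30000 * k ^ 7 + 10000 * k ^ 8 := by ring
      _ ≤ _ := by
          have : (k : ℝ) ^ 7 ≤ k ^ 8 := pow_le_pow_right₀ (by linarith) (by norm_num)
          have : (0 : ℝ) ≤ k ^ 8 := by positivity
          linarith
  · intro r hr hr'
    rw [← sub_nonneg, windowPhase_gap N (Or.inr rfl) hX0
      ((hw (r + 1) (by omega) (by omega)).one_lt hk hkX)]
    have h3 := (hw (r + 1) (by omega) (by omega)).two_le_sq hk hkX
    have h4 : 1 / ((X : ℝ) + -1 * (r + 1 : ℕ)) ^ 2 < 1 := by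
      rw [div_lt_one (by linarith)]
      linarith
    have := le_neg_log_one_sub h4
    have : 0 ≤ 1 / ((X : ℝ) + -1 * (r + 1 : ℕ)) ^ 2 := by positivity
    apply mul_nonneg (by positivity)
    linarith
  · intro r hr hr'
    have hin := hw r hr (by omega)
    have hpos := hin.pos
    rw [hd r hr (by omega)]
    have hlow : (X : ℝ) / k ≤ X + -1 * r := by
      rw [div_le_iff₀ (by linarith)]
      apply (pow_le_pow_iff_left₀ hX0.le (by positivity) two_ne_zero).1
      refine hin.lower.trans ?_
      rw [mul_pow]
      nlinarith [sq_nonneg ((X : ℝ) + -1 * r)]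
    have hu : 1 / ((X : ℝ) + -1 * r) ≤ k / X := by
      rw [div_le_div_iff₀ hpos hX0]
      rw [div_le_iff₀ (by linarith)] at hlow
      linarith
    have hu2 : (k : ℝ) / X ≤ 1 / (100 * N) := by
      rw [div_le_div_iff₀ hX0 (by linarith)]
      linarith
    have hu3 : 1 / (100 * (N : ℝ)) ≤ 1 / 2 := by
      gcongr
      linarith
    have h5 := neg_log_one_sub_le (u := 1 / ((X : ℝ) + -1 * r)) (by positivity) (by linarith)
    have h6 : (2 * N + 1) / (2 * Real.log k) * -Real.log (1 - 1 / (X + -1 * r)) ≤ 1 / 2 := by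
      calc _ ≤ (3 * (N : ℝ)) / (2 * (1 / 2)) * (2 * (1 / (100 * (N : ℝ)))) := by
            have : -Real.log (1 - 1 / ((X : ℝ) + -1 * r)) ≤ 2 * (1 / (100 * N)) := by linarith
            have : 0 ≤ -Real.log (1 - 1 / ((X : ℝ) + -1 * r)) := le_trans (by positivity)
              (le_neg_log_one_sub (u := 1 / ((X : ℝ) + -1 * r)) (by linarith))
            gcongr
            linarith
        _ = 6 / 100 := by field_simp; norm_num
        _ ≤ _ := by norm_num
    push_cast
    linarith
  · intro r hr hr'
    have hin := hw r hr (by omega)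
    have hpos := hin.pos
    have h1m := hin.one_lt hk hkX
    rw [hd r hr (by omega)]
    have h5 := le_neg_log_one_sub (u := 1 / ((X : ℝ) + -1 * r)) (by
      rw [div_lt_one hpos]
      exact h1m)
    have h6 : θ ≤ (2 * N + 1) / (2 * Real.log k) * -Real.log (1 - 1 / (X + -1 * r)) := by
      calc θ = (2 * N) / (2 * k) * (1 / (100 * k ^ 2 * N)) := by
            rw [hθ]
            field_simp
        _ ≤ _ := by
            have : 1 / (100 * (k : ℝ) ^ 2 * N) ≤ -Real.log (1 - 1 / (X + -1 * r)) := by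
              refine le_trans ?_ h5
              gcongr
              have : (0 : ℝ) ≤ r := by positivity
              linarith
            gcongr
            linarith
    push_cast
    linarith

end WindowLengths

/-- The sum of the remainder over the right window of `X`. -/
noncomputable def rightWindowSum (k N X : ℕ) : ℝ :=
  ∑ r ∈ Finset.Ico 1 (rightLength k X), sineRemainder N (windowPoint k 1 X r)

/-- The sum of the remainder over the left window of `X`. -/
noncomputable def leftWindowSum (k N X : ℕ) : ℝ :=
  ∑ r ∈ Finset.Ico 1 (leftLength k X), sineRemainder N (windowPoint k (-1) X r)

section WindowTotal

variable {k : ℕ}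

lemma sum_pow_of_pow_lt_le (hk : 2 ≤ k) {N : ℕ} (hN : 2 ≤ N) (L : ℕ) :
    ∑ j ∈ Finset.range L, (if (k ^ j) ^ 2 < N then (k ^ j) ^ 2 else 0) ≤ k ^ 2 * N := by
  have hk2 : 2 ≤ k ^ 2 := by nlinarith
  rw [← Finset.sum_filter]
  have h := Nat.geomSum_lt (m := k ^ 2) (n := Nat.clog (k ^ 2) N)
    (s := (Finset.range L).filter fun j ↦ (k ^ j) ^ 2 < N) hk2 ?_
  · have h2 := Nat.pow_pred_clog_lt_self (b := k ^ 2) (x := N) (by omega) (by omega)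
    have h3 : (k ^ 2) ^ Nat.clog (k ^ 2) N ≤ k ^ 2 * N := by
      have h4 : 0 < Nat.clog (k ^ 2) N := Nat.clog_pos (by omega) hN
      obtain ⟨c, hc⟩ := Nat.exists_eq_succ_of_ne_zero h4.ne'
      rw [hc, Nat.pred_succ] at h2
      rw [hc, pow_succ, mul_comm]
      gcongr
    refine le_trans (le_of_eq ?_) (h.le.trans h3)
    exact Finset.sum_congr rfl fun j _ ↦ by rw [← pow_mul, ← pow_mul, mul_comm]
  · intro j hj
    rw [Finset.mem_filter] at hj
    rw [Nat.lt_clog_iff_pow_lt (by omega), ← pow_mul, mul_comm 2 j, pow_mul]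
    exact hj.2

lemma abs_right_sub_left_le {N j : ℕ} {q : ℝ} (hk : 2 ≤ k) (hq : 4 ≤ q) (hqN : q ^ 4 = N) :
    |rightWindowSum k N (k ^ j) - leftWindowSum k N (k ^ j)|
      ≤ 1000 * k ^ 5 * (1 / q + (k : ℝ) ^ j / N + if (k ^ j) ^ 2 < N then ((k : ℝ) ^ j) ^ 2 / N
        else 0) := by
  have hk2 : (2 : ℝ) ≤ k := by exact_mod_cast hk
  have hq0 : 0 < q := by linarith
  have hN0 : (0 : ℝ) < N := by rw [← hqN]; positivity
  have hN1 : 1 ≤ N := by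
    have : 0 < N := by exact_mod_cast hN0
    omega
  have hX1 : 1 ≤ k ^ j := Nat.one_le_pow _ _ (by omega)
  have hX1' : (1 : ℝ) ≤ (k ^ j : ℕ) := by exact_mod_cast hX1
  have hcast : ((k ^ j : ℕ) : ℝ) = (k : ℝ) ^ j := by push_cast; rfl
  have p1 : (0 : ℝ) ≤ k ^ 5 * (1 / q) := by positivity
  have p2 : (0 : ℝ) ≤ k ^ 5 * ((k : ℝ) ^ j / N) := by positivity
  have p3 : (0 : ℝ) ≤ k ^ 5 * (((k : ℝ) ^ j) ^ 2 / N) := by positivity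
  have hp : ∀ r, 1 ≤ r → r < rightLength k (k ^ j) → InWindow k 1 (k ^ j : ℕ) r :=
    fun r _ hr ↦ inWindow_right hk hX1 hr
  have hm : ∀ r, 1 ≤ r → r < leftLength k (k ^ j) → InWindow k (-1) (k ^ j : ℕ) r :=
    fun r _ hr ↦ inWindow_left hk hX1 hr
  split_ifs with h
  · have hXN : ((k ^ j : ℕ) : ℝ) ≤ N := by
      have : k ^ j ≤ N := (Nat.le_self_pow two_ne_zero _).trans h.le
      exact_mod_cast this
    have h1 := abs_window_le hk (Or.inl rfl) hX1' hN1 hXN hp (rightLength_le hk hX1)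
    have h2 := abs_window_le hk (Or.inr rfl) hX1' hN1 hXN hm (leftLength_le hk)
    rw [rightWindowSum, leftWindowSum]
    rw [hcast] at h1 h2 ⊢
    rw [abs_le] at h1 h2 ⊢
    constructor <;> linarith
  · push Not at h
    have hkX : k ≤ k ^ j := by
      apply Nat.le_self_pow
      rintro rfl
      have : (256 : ℝ) ≤ N := by
        rw [← hqN]
        calc (256 : ℝ) = 4 ^ 4 := by norm_num
          _ ≤ q ^ 4 := by gcongr
      have : 256 ≤ N := by exact_mod_cast this
      simp at h
      omega
    rw [add_zero, rightWindowSum, leftWindowSum, ← hcast]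
    exact abs_window_sub_window_le hk (by exact_mod_cast hkX) hq hqN (by exact_mod_cast h) hp hm
      (le_rightLength hk) (le_leftLength hk) (rightLength_le hk hX1) (leftLength_le hk)

lemma abs_sum_windows_le {N L : ℕ} (hk : 2 ≤ k) (hN : 256 ≤ N)
    (hL1 : 100 * k * N ≤ k ^ L) (hL2 : k ^ L ≤ 100 * k ^ 2 * N) :
    |∑ j ∈ Finset.range L, (rightWindowSum k N (k ^ j) - leftWindowSum k N (k ^ j))
      - leftWindowSum k N (k ^ L)| ≤ 1000000 * k ^ 8 := by
  have hk2 : (2 : ℝ) ≤ k := by exact_mod_cast hk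
  have hκ := one_half_lt_log_of_two_le hk
  have hN' : (256 : ℝ) ≤ N := by exact_mod_cast hN
  set q : ℝ := √√(N : ℝ) with hq
  have hqN : q ^ 4 = N := by
    rw [show q ^ 4 = (q ^ 2) ^ 2 by ring, hq, Real.sq_sqrt (by positivity),
      Real.sq_sqrt (by positivity)]
  have hq4 : 4 ≤ q := by
    rw [hq]
    apply Real.le_sqrt_of_sq_le
    apply Real.le_sqrt_of_sq_le
    linarith
  have hLq : (L : ℝ) / q ≤ 250 * k ^ 2 := by
    have h1 : Real.log ((k : ℝ) ^ L) ≤ Real.log (100 * k ^ 2 * N) :=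
      Real.log_le_log (by positivity) (by exact_mod_cast hL2)
    rw [Real.log_pow, Real.log_mul (by positivity) (by positivity), ← hqN, Real.log_pow] at h1
    have h2 : Real.log (100 * (k : ℝ) ^ 2) ≤ 100 * k ^ 2 :=
      (Real.log_le_sub_one_of_pos (by positivity)).trans (by linarith)
    have h3 : Real.log q ≤ q := (Real.log_le_sub_one_of_pos (by linarith)).trans (by linarith)
    have h4 : (L : ℝ) * (1 / 2) ≤ L * Real.log k := by gcongr
    rw [div_le_iff₀ (by linarith)]
    push_cast at h1
    have h5 : (4 : ℝ) ≤ k ^ 2 := by nlinarith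
    nlinarith [mul_nonneg (sub_nonneg.2 h5) (sub_nonneg.2 hq4)]
  have hgeom : ∑ j ∈ Finset.range L, (k : ℝ) ^ j / N ≤ 100 * k ^ 2 := by
    rw [← Finset.sum_div, div_le_iff₀ (by linarith)]
    have h1 := (Nat.geomSum_lt (m := k) (n := L) (s := Finset.range L) hk
      fun j hj ↦ Finset.mem_range.1 hj).le.trans hL2
    exact_mod_cast h1
  have hsq : ∑ j ∈ Finset.range L, (if (k ^ j) ^ 2 < N then ((k : ℝ) ^ j) ^ 2 / N else 0)
      ≤ k ^ 2 := by
    have h1 : (∑ j ∈ Finset.range L, (if (k ^ j) ^ 2 < N then ((k : ℝ) ^ j) ^ 2 else 0))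
        ≤ k ^ 2 * N := by
      have := sum_pow_of_pow_lt_le hk (by omega : 2 ≤ N) L
      exact_mod_cast this
    rw [← div_le_iff₀ (by linarith), Finset.sum_div] at h1
    refine le_trans (le_of_eq ?_) h1
    exact Finset.sum_congr rfl fun j _ ↦ by split_ifs <;> simp
  have hmain : |∑ j ∈ Finset.range L, (rightWindowSum k N (k ^ j) - leftWindowSum k N (k ^ j))|
      ≤ 1000 * k ^ 5 * (250 * k ^ 2 + 100 * k ^ 2 + k ^ 2) := by
    refine (Finset.abs_sum_le_sum_abs _ _).trans ((Finset.sum_le_sum fun j _ ↦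
      abs_right_sub_left_le hk hq4 hqN).trans ?_)
    rw [← Finset.mul_sum, Finset.sum_add_distrib, Finset.sum_add_distrib, Finset.sum_const,
      Finset.card_range, nsmul_eq_mul, mul_one_div]
    gcongr
  have htop : |leftWindowSum k N (k ^ L)| ≤ 100000 * k ^ 8 :=
    abs_top_window_le hk (by omega) hL1 hL2
  have h7 : (k : ℝ) ^ 7 ≤ k ^ 8 := pow_le_pow_right₀ (by linarith) (by norm_num)
  have h8 : (0 : ℝ) ≤ k ^ 8 := by positivity
  have h9 : 1000 * (k : ℝ) ^ 5 * (250 * k ^ 2 + 100 * k ^ 2 + k ^ 2) = 351000 * k ^ 7 := by ring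
  rw [h9] at hmain
  rw [abs_le] at hmain htop ⊢
  constructor <;> linarith

end WindowTotal

/-- The partial Fourier sum `∑_{n ≤ N} sin (2πnx) / n`. -/
noncomputable def sineSum (N : ℕ) (x : ℝ) : ℝ :=
  ∑ n ∈ Finset.range N, Real.sin (2 * Real.pi * (n + 1) * x) / (n + 1)

lemma sineSum_eq (N : ℕ) (x : ℝ) : sineSum N x = sineRemainder N x + Real.pi * (1 / 2 - x) := by
  rw [sineRemainder, sineSum]
  ring

lemma sineSum_add_natCast (N : ℕ) (x : ℝ) (j : ℕ) : sineSum N (x + j) = sineSum N x := by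
  refine Finset.sum_congr rfl fun n _ ↦ ?_
  rw [show 2 * Real.pi * (n + 1) * (x + j) = 2 * Real.pi * (n + 1) * x
    + (((n + 1) * j : ℕ) : ℝ) * (2 * Real.pi) by push_cast; ring, Real.sin_add_nat_mul_two_pi]

lemma sineSum_neg (N : ℕ) (x : ℝ) : sineSum N (-x) = -sineSum N x := by
  rw [sineSum, sineSum, ← Finset.sum_neg_distrib]
  refine Finset.sum_congr rfl fun n _ ↦ ?_
  rw [mul_neg, Real.sin_neg, neg_div]

lemma sineSum_zero (N : ℕ) : sineSum N 0 = 0 := by simp [sineSum]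

/-- The sine sum at `log_k m`, minus its limiting sawtooth value. -/
noncomputable def sineDefect (k N m : ℕ) : ℝ :=
  sineSum N (Real.log m / Real.log k)
    - Real.pi * (1 / 2 - Real.log m / Real.log k + Nat.log k m)

section Decomposition

variable {k : ℕ}

lemma sineDefect_pow (hk : 2 ≤ k) (N j : ℕ) : sineDefect k N (k ^ j) = -(Real.pi / 2) := by
  have hκ := one_half_lt_log_of_two_le hk
  have h : Real.log ((k ^ j : ℕ) : ℝ) / Real.log k = j := by
    push_cast
    rw [Real.log_pow]
    field_simp
  rw [sineDefect, h, Nat.log_pow (by omega), ← zero_add (j : ℝ), sineSum_add_natCast,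
    sineSum_zero]
  ring

lemma sineDefect_add {N j r : ℕ} (hk : 2 ≤ k) (hr : r < rightLength k (k ^ j))
    (hr' : k ^ j + r < k ^ (j + 1)) :
    sineDefect k N (k ^ j + r) = sineRemainder N (windowPoint k 1 (k ^ j : ℕ) r) := by
  have hκ := one_half_lt_log_of_two_le hk
  have hX : 1 ≤ k ^ j := Nat.one_le_pow _ _ (by omega)
  have hX0 : (0 : ℝ) < (k ^ j : ℕ) := by exact_mod_cast hX
  have hpos := (inWindow_right hk hX hr).pos
  have h : Real.log ((k ^ j + r : ℕ) : ℝ) / Real.log k = windowPoint k 1 (k ^ j : ℕ) r + j := by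
    rw [windowPoint, Real.log_div hpos.ne' hX0.ne']
    push_cast
    rw [Real.log_pow]
    field_simp
    ring
  rw [sineDefect, h, Nat.log_eq_of_pow_le_of_lt_pow (Nat.le_add_right _ _) hr',
    sineSum_add_natCast, sineSum_eq]
  ring

lemma sineDefect_sub {N j r : ℕ} (hk : 2 ≤ k) (hr1 : 1 ≤ r)
    (hr : r < leftLength k (k ^ (j + 1))) (hr' : k ^ j ≤ k ^ (j + 1) - r) :
    sineDefect k N (k ^ (j + 1) - r)
      = -sineRemainder N (windowPoint k (-1) (k ^ (j + 1) : ℕ) r) := by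
  have hκ := one_half_lt_log_of_two_le hk
  have hX : 1 ≤ k ^ (j + 1) := Nat.one_le_pow _ _ (by omega)
  have hX0 : (0 : ℝ) < (k ^ (j + 1) : ℕ) := by exact_mod_cast hX
  have hpos := (inWindow_left hk hX hr).pos
  have hrX : r ≤ k ^ (j + 1) := by
    rw [leftLength] at hr
    omega
  have h : Real.log ((k ^ (j + 1) - r : ℕ) : ℝ) / Real.log k
      = -windowPoint k (-1) (k ^ (j + 1) : ℕ) r + (j + 1 : ℕ) := by
    rw [windowPoint, Real.log_div hpos.ne' hX0.ne', Nat.cast_sub hrX]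
    push_cast
    rw [Real.log_pow]
    push_cast
    field_simp
    ring_nf
  rw [sineDefect, h, Nat.log_eq_of_pow_le_of_lt_pow hr' (by omega),
    sineSum_add_natCast, sineSum_neg, sineSum_eq]
  push_cast
  ring

lemma rightLength_add_leftLength (hk : 2 ≤ k) (X : ℕ) :
    X + rightLength k X = k * X + 1 - leftLength k (k * X) := by
  have h1 : (k * X) ^ 2 / k = k * X ^ 2 := by
    rw [show (k * X) ^ 2 = k * (k * X ^ 2) by ring, Nat.mul_div_cancel_left _ (by omega)]
  have h2 := sqrt_sq_div_le k (k * X)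
  have h3 := le_sqrt_mul_sq hk X
  rw [leftLength, rightLength]
  rw [h1] at h2 ⊢
  omega

lemma sum_sineDefect_block (hk : 2 ≤ k) (N j : ℕ) :
    ∑ m ∈ Finset.Ico (k ^ j) (k ^ (j + 1)), sineDefect k N m
      = -(Real.pi / 2) + rightWindowSum k N (k ^ j) - leftWindowSum k N (k ^ (j + 1)) := by
  have hX : 1 ≤ k ^ j := Nat.one_le_pow _ _ (by omega)
  have hsum := rightLength_add_leftLength hk (k ^ j)
  have hpow : k ^ (j + 1) = k * k ^ j := pow_succ' _ _
  rw [← hpow] at hsum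
  have hX2 : 2 * k ^ j ≤ k ^ (j + 1) := by
    rw [hpow]
    gcongr
  have hl : 1 ≤ leftLength k (k ^ (j + 1)) := by
    have h := le_leftLength (X := k ^ (j + 1)) hk
    have h2 : k ^ (j + 1) ≤ 4 * leftLength k (k ^ (j + 1)) := by exact_mod_cast h
    omega
  have hr1 : 1 ≤ rightLength k (k ^ j) := by
    rw [rightLength]
    omega
  have hle : leftLength k (k ^ (j + 1)) ≤ k ^ (j + 1) := Nat.sub_le _ _
  rw [← Finset.sum_Ico_consecutive _ (by omega : k ^ j ≤ k ^ j + 1) (by omega),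
    ← Finset.sum_Ico_consecutive _ (by omega : k ^ j + 1 ≤ k ^ j + rightLength k (k ^ j))
      (by omega),
    Nat.Ico_succ_singleton, Finset.sum_singleton, sineDefect_pow hk]
  have e1 : ∑ m ∈ Finset.Ico (k ^ j + 1) (k ^ j + rightLength k (k ^ j)), sineDefect k N m
      = rightWindowSum k N (k ^ j) := by
    have h := Finset.sum_Ico_add (fun m ↦ sineDefect k N m) 1 (rightLength k (k ^ j)) (k ^ j)
    rw [add_comm 1, add_comm (rightLength k (k ^ j))] at h
    rw [← h, rightWindowSum]
    refine Finset.sum_congr rfl fun r hr ↦ ?_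
    obtain ⟨hr, hr'⟩ := Finset.mem_Ico.1 hr
    exact sineDefect_add hk hr' (by omega)
  have e2 : ∑ m ∈ Finset.Ico (k ^ j + rightLength k (k ^ j)) (k ^ (j + 1)), sineDefect k N m
      = -leftWindowSum k N (k ^ (j + 1)) := by
    have h := Finset.sum_Ico_reflect (fun m ↦ sineDefect k N m) 1
      (m := leftLength k (k ^ (j + 1))) (n := k ^ (j + 1)) (by omega)
    rw [← hsum, Nat.add_sub_cancel] at h
    rw [← h, leftWindowSum, ← Finset.sum_neg_distrib]
    refine Finset.sum_congr rfl fun r hr ↦ ?_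
    obtain ⟨hr, hr'⟩ := Finset.mem_Ico.1 hr
    exact sineDefect_sub hk hr hr' (by omega)
  rw [e1, e2]
  ring

lemma leftWindowSum_one (k N : ℕ) : leftWindowSum k N 1 = 0 := by
  rw [leftWindowSum, Finset.Ico_eq_empty_of_le, Finset.sum_empty]
  exact Nat.sub_le _ _

lemma sum_sineDefect (hk : 2 ≤ k) (N L : ℕ) :
    ∑ m ∈ Finset.Ico 1 (k ^ L), sineDefect k N m
      = -(Real.pi / 2) * L + (∑ j ∈ Finset.range L,
        (rightWindowSum k N (k ^ j) - leftWindowSum k N (k ^ j)) - leftWindowSum k N (k ^ L)) := by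
  induction L with
  | zero => simp [leftWindowSum_one]
  | succ L ih =>
    rw [← Finset.sum_Ico_consecutive _ (Nat.one_le_pow L k (by omega))
      (Nat.pow_le_pow_right (by omega) (Nat.le_succ L)), ih, sum_sineDefect_block hk,
      Finset.sum_range_succ]
    push_cast
    ring

end Decomposition

/-- The mean value of the sawtooth `1/2 - {x}` at the points `log_k m`, up to sign. -/
noncomputable def sawtoothMean (k : ℕ) : ℝ := (k + 1) / (2 * (k - 1)) - 1 / Real.log k

lemma sum_natLog {k : ℕ} (hk : 2 ≤ k) (L : ℕ) :
    ∑ m ∈ Finset.Ico 1 (k ^ L), (Nat.log k m : ℝ)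
      = L * (k : ℝ) ^ L - k * ((k : ℝ) ^ L - 1) / (k - 1) := by
  have hk' : (2 : ℝ) ≤ k := by exact_mod_cast hk
  have hk1 : (k : ℝ) - 1 ≠ 0 := by linarith
  induction L with
  | zero => simp
  | succ L ih =>
    have hle : k ^ L ≤ k ^ (L + 1) := Nat.pow_le_pow_right (by omega) (Nat.le_succ L)
    have hblock : ∑ m ∈ Finset.Ico (k ^ L) (k ^ (L + 1)), (Nat.log k m : ℝ)
        = ((k : ℝ) ^ (L + 1) - (k : ℝ) ^ L) * L := by
      rw [Finset.sum_congr rfl (g := fun _ ↦ (L : ℝ)), Finset.sum_const, Nat.card_Ico,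
        nsmul_eq_mul, Nat.cast_sub hle]
      · push_cast
        ring
      · intro m hm
        obtain ⟨h1, h2⟩ := Finset.mem_Ico.1 hm
        rw [Nat.log_eq_of_pow_le_of_lt_pow h1 h2]
    rw [← Finset.sum_Ico_consecutive _ (Nat.one_le_pow L k (by omega)) hle, ih, hblock]
    push_cast
    field_simp
    ring

lemma sum_log_Ico (M : ℕ) : ∑ m ∈ Finset.Ico 1 (M + 1), Real.log m = Real.log M.factorial := by
  induction M with
  | zero => simp
  | succ M ih =>
    rw [Finset.sum_Ico_succ_top (by omega), ih, Nat.factorial_succ, Nat.cast_mul,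
      Real.log_mul (by positivity) (by positivity)]
    ring

lemma abs_log_factorial_sub_le {M : ℕ} (hM : 1 ≤ M) :
    |Real.log M.factorial - (M * Real.log M - M + Real.log M / 2)| ≤ 2 := by
  have hM0 : (0 : ℝ) < M := by exact_mod_cast hM
  have h := Stirling.log_stirlingSeq_formula M
  rw [Real.log_mul two_ne_zero hM0.ne', Real.log_div hM0.ne' (Real.exp_ne_zero 1),
    Real.log_exp] at h
  have h1 : Stirling.stirlingSeq M ≤ Real.exp 1 := by
    have h2 := Stirling.stirlingSeq'_antitone (Nat.zero_le (M - 1))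
    simp only [Function.comp_apply, Nat.succ_eq_add_one, Nat.sub_add_cancel hM, zero_add,
      Stirling.stirlingSeq_one] at h2
    refine h2.trans (div_le_self (Real.exp_pos 1).le ?_)
    exact Real.one_le_sqrt.2 one_le_two
  have h3 : 1 ≤ Stirling.stirlingSeq M :=
    (Real.one_le_sqrt.2 (by linarith [Real.pi_gt_three])).trans
      (Stirling.sqrt_pi_le_stirlingSeq (by omega))
  have h4 := Real.log_nonneg h3
  have h5 : Real.log (Stirling.stirlingSeq M) ≤ 1 :=
    (Real.log_le_iff_le_exp (by linarith)).2 h1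
  have h6 := Real.log_two_lt_d9
  have h7 := Real.log_two_gt_d9
  rw [abs_le]
  constructor <;> linarith

lemma abs_sum_sawtooth_le {k : ℕ} (hk : 2 ≤ k) (L : ℕ) :
    |∑ m ∈ Finset.Ico 1 (k ^ L), (1 / 2 - Real.log m / Real.log k + Nat.log k m)
      - L / 2 + sawtoothMean k * (k : ℝ) ^ L| ≤ 10 := by
  have hκ := one_half_lt_log_of_two_le hk
  have hκ0 : Real.log k ≠ 0 := by linarith
  have hk' : (2 : ℝ) ≤ k := by exact_mod_cast hk
  have hk1 : (k : ℝ) - 1 ≠ 0 := by linarith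
  have hM : 1 ≤ k ^ L := Nat.one_le_pow _ _ (by omega)
  have hlog := sum_log_Ico (k ^ L)
  rw [Finset.sum_Ico_succ_top hM] at hlog
  have hst := abs_log_factorial_sub_le hM
  set δ := Real.log (k ^ L).factorial
    - ((k ^ L : ℕ) * Real.log (k ^ L : ℕ) - (k ^ L : ℕ) + Real.log (k ^ L : ℕ) / 2) with hδ
  have hlogM : Real.log ((k ^ L : ℕ) : ℝ) = L * Real.log k := by
    push_cast
    rw [Real.log_pow]
  have hsum : ∑ m ∈ Finset.Ico 1 (k ^ L), Real.log m
      = (k : ℝ) ^ L * (L * Real.log k) - (k : ℝ) ^ L - L * Real.log k / 2 + δ := by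
    rw [hlogM] at hδ hlog
    push_cast at hδ
    linarith
  have hmain : ∑ m ∈ Finset.Ico 1 (k ^ L), (1 / 2 - Real.log m / Real.log k + Nat.log k m)
      - L / 2 + sawtoothMean k * (k : ℝ) ^ L
      = -(1 / 2) + (1 + 1 / (k - 1)) - δ / Real.log k := by
    rw [Finset.sum_add_distrib, Finset.sum_sub_distrib,
      ← Finset.sum_div _ (fun m : ℕ ↦ Real.log m), hsum, sum_natLog hk,
      Finset.sum_const, Nat.card_Ico, nsmul_eq_mul, Nat.cast_sub hM, sawtoothMean]
    push_cast
    field_simp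
    ring
  have h1 : |δ / Real.log k| ≤ 4 := by
    rw [abs_div, abs_of_pos (by linarith : (0 : ℝ) < Real.log k), div_le_iff₀ (by linarith)]
    linarith
  have h2 : 1 / ((k : ℝ) - 1) ≤ 1 := by
    rw [div_le_one (by linarith)]
    linarith
  have h3 : 0 ≤ 1 / ((k : ℝ) - 1) := div_nonneg zero_le_one (by linarith)
  rw [hmain, abs_le]
  obtain ⟨h4, h5⟩ := abs_le.1 h1
  constructor <;> linarith

lemma hasSum_lorentzian {k : ℕ} (hk : 2 ≤ k) {α : ℝ} (hα : α = 2 * Real.pi / Real.log k) :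
    HasSum (fun n : ℕ ↦ α / (1 + (α * (n + 1)) ^ 2)) (Real.pi * sawtoothMean k) := by
  have hκ := one_half_lt_log_of_two_le hk
  have hπ := Real.pi_pos
  have hα0 : 0 < α := by
    rw [hα]
    exact div_pos (by linarith) (by linarith)
  have hαc : (α : ℂ) ≠ 0 := by exact_mod_cast hα0.ne'
  have hk' : (2 : ℝ) ≤ k := by exact_mod_cast hk
  have hkc : (k : ℂ) - 1 ≠ 0 := by
    have h : ((k - 1 : ℝ) : ℂ) ≠ 0 := by
      exact_mod_cast (by linarith : (k : ℝ) - 1 ≠ 0)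
    simpa using h
  set z : ℂ := I / α with hz
  have hzI : z ∈ integerComplement := by
    rw [mem_integerComplement_iff]
    rintro ⟨n, hn⟩
    have h := congrArg Complex.im hn
    rw [hz, Complex.div_ofReal_im] at h
    simp at h
    exact hα0.ne h
  have hs := (summable_cotTerm hzI).hasSum
  have hexp : Complex.exp (2 * Real.pi * I * z) = (k : ℂ)⁻¹ := by
    have h : 2 * (Real.pi : ℂ) * I * z = ((-Real.log k : ℝ) : ℂ) := by
      rw [hz, show 2 * (Real.pi : ℂ) * I * (I / α) = (I * I) * (2 * Real.pi / α) by ring,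
        Complex.I_mul_I, hα]
      push_cast
      have : (Real.log k : ℂ) ≠ 0 := by exact_mod_cast (by linarith : Real.log k ≠ 0)
      have : (Real.pi : ℂ) ≠ 0 := by exact_mod_cast hπ.ne'
      field_simp
    rw [h, ← Complex.ofReal_exp, Real.exp_neg, Real.exp_log (by linarith)]
    push_cast
    rfl
  have hval : ∑' n : ℕ, cotTerm z n = -(2 * I) * ((Real.pi * sawtoothMean k : ℝ) : ℂ) := by
    have h := cot_series_rep' hzI
    rw [Complex.cot_pi_eq_exp_ratio, hexp] at h
    rw [show (fun n : ℕ ↦ 1 / (z - (n + 1)) + 1 / (z + (n + 1))) = cotTerm z from rfl] at h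
    rw [← h, sawtoothMean, hz, hα]
    have : (Real.log k : ℂ) ≠ 0 := by exact_mod_cast (by linarith : Real.log k ≠ 0)
    have : (Real.pi : ℂ) ≠ 0 := by exact_mod_cast hπ.ne'
    have hk0 : (k : ℂ) ≠ 0 := by exact_mod_cast (by omega : k ≠ 0)
    have h1 : 1 - (k : ℂ)⁻¹ ≠ 0 := by
      rw [show 1 - (k : ℂ)⁻¹ = (k - 1) / k by field_simp]
      exact div_ne_zero hkc hk0
    push_cast
    field_simp
    rw [Complex.I_sq]
    ring
  have hterm : ∀ n : ℕ, cotTerm z n = -(2 * I) * ((α / (1 + (α * (n + 1)) ^ 2) : ℝ) : ℂ) := by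
    intro n
    have hne : (1 + ((α : ℂ) * (n + 1)) ^ 2) ≠ 0 := by
      exact_mod_cast (by positivity : (1 + (α * (n + 1)) ^ 2) ≠ 0)
    have hprod : (z + (n + 1)) * (z - (n + 1)) = -(1 + ((α : ℂ) * (n + 1)) ^ 2) / α ^ 2 := by
      rw [hz]
      field_simp
      linear_combination Complex.I_sq
    rw [cotTerm_identity hzI, hprod, hz]
    push_cast
    field_simp
  rw [hval] at hs
  simp only [hterm] at hs
  have h2 : (-(2 * I) : ℂ) ≠ 0 := by simp
  rw [hasSum_mul_left_iff h2] at hs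
  exact_mod_cast hs

lemma abs_sum_lorentzian_sub_le {k N : ℕ} (hk : 2 ≤ k) (hN : 1 ≤ N) {α : ℝ}
    (hα : α = 2 * Real.pi / Real.log k) :
    |∑ n ∈ Finset.range N, α / (1 + (α * (n + 1)) ^ 2) - Real.pi * sawtoothMean k|
      ≤ 2 / (α * N) := by
  have hκ := one_half_lt_log_of_two_le hk
  have hα0 : 0 < α := by
    rw [hα]
    exact div_pos (by linarith [Real.pi_pos]) (by linarith)
  have hs := hasSum_lorentzian hk hα
  have hN0 : (0 : ℝ) < N := by exact_mod_cast hN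
  have h1 : ∑ n ∈ Finset.range N, α / (1 + (α * (n + 1)) ^ 2) ≤ Real.pi * sawtoothMean k :=
    sum_le_hasSum _ (fun n _ ↦ by positivity) hs
  have h2 : Real.pi * sawtoothMean k
      ≤ ∑ n ∈ Finset.range N, α / (1 + (α * (n + 1)) ^ 2) + 2 / (α * N) := by
    refine le_of_tendsto hs.tendsto_sum_nat (Filter.eventually_atTop.2 ⟨N, fun K hK ↦ ?_⟩)
    rw [← Finset.sum_range_add_sum_Ico _ hK]
    gcongr
    calc ∑ n ∈ Finset.Ico N K, α / (1 + (α * (n + 1)) ^ 2)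
        ≤ ∑ n ∈ Finset.Ico N K, 1 / α * (1 / (n : ℝ) ^ 2) := by
          refine Finset.sum_le_sum fun n hn ↦ ?_
          have hn0 : (0 : ℝ) < n := by
            exact_mod_cast hN.trans (Finset.mem_Ico.1 hn).1
          rw [← mul_div_mul_comm, div_le_div_iff₀ (by positivity) (by positivity)]
          nlinarith [mul_pos hα0 hα0, mul_pos (mul_pos hα0 hα0) hn0]
      _ ≤ 1 / α * (2 / N) := by
          rw [← Finset.mul_sum]
          gcongr
          exact sum_one_div_sq_le hN K
      _ = 2 / (α * N) := by field_simp
  rw [abs_le]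
  constructor <;> linarith [show 0 ≤ 2 / (α * N) by positivity]

section TrapezoidRule

/-- The error of the trapezoid rule for `∫ x ^ (-s)` over `[m, m + 1]`, multiplied by `s - 1`. -/
noncomputable def trapezoidError (m : ℕ) (s : ℂ) : ℂ :=
  (s - 1) * ((m : ℂ) ^ (-s) + ((m + 1 : ℕ) : ℂ) ^ (-s)) / 2
    - ((m : ℂ) ^ (1 - s) - ((m + 1 : ℕ) : ℂ) ^ (1 - s))

lemma hasDerivAt_ofReal_cpow {x : ℝ} (hx : 0 < x) (r : ℂ) :
    HasDerivAt (fun y : ℝ ↦ (y : ℂ) ^ r) (r * (x : ℂ) ^ (r - 1)) x := by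
  have h := ((hasDerivAt_id (x : ℂ)).cpow_const (c := r)
    (by simpa using Complex.ofReal_mem_slitPlane.2 hx)).comp_ofReal
  simpa using h

lemma norm_cpow_tangent_error_le {a x : ℝ} (ha : 0 < a) (hx : x ∈ Set.Icc a (a + 1)) {s : ℂ}
    (hs : -2 ≤ s.re) :
    ‖(x : ℂ) ^ (-s) + s * (x - a) * (x : ℂ) ^ (-s - 1) - (a : ℂ) ^ (-s)‖
      ≤ ‖s‖ * ‖s + 1‖ * a ^ (-s.re - 2) := by
  set f : ℝ → ℂ := fun x ↦ (x : ℂ) ^ (-s) + s * (x - a) * (x : ℂ) ^ (-s - 1) with hf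
  have hderiv : ∀ y ∈ Set.Icc a (a + 1), HasDerivWithinAt f
      (-(s * (s + 1) * (y - a) * (y : ℂ) ^ (-s - 2))) (Set.Icc a (a + 1)) y := by
    intro y hy
    have hy0 := ha.trans_le hy.1
    have h1 := hasDerivAt_ofReal_cpow hy0 (-s)
    have h2 := hasDerivAt_ofReal_cpow hy0 (-s - 1)
    have h3 : HasDerivAt (fun x : ℝ ↦ s * ((x : ℂ) - a)) s y := by
      simpa using (((hasDerivAt_id (y : ℂ)).sub_const (a : ℂ)).const_mul s).comp_ofReal
    refine ((h1.add (h3.mul h2)).congr_deriv ?_).hasDerivWithinAt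
    rw [show -s - 1 - 1 = -s - 2 by ring]
    ring
  have hbound : ∀ y ∈ Set.Ico a (a + 1),
      ‖-(s * (s + 1) * (y - a) * (y : ℂ) ^ (-s - 2))‖ ≤ ‖s‖ * ‖s + 1‖ * a ^ (-s.re - 2) := by
    intro y hy
    have hy0 := ha.trans_le hy.1
    have h1 : ‖(y : ℂ) - a‖ ≤ 1 := by
      rw [← Complex.ofReal_sub, Complex.norm_real, Real.norm_eq_abs,
        abs_of_nonneg (sub_nonneg.2 hy.1)]
      linarith [hy.2]
    have h2 : ‖(y : ℂ) ^ (-s - 2)‖ ≤ a ^ (-s.re - 2) := by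
      rw [Complex.norm_cpow_eq_rpow_re_of_pos hy0]
      simp only [sub_re, neg_re, re_ofNat]
      exact Real.rpow_le_rpow_of_nonpos ha hy.1 (by linarith)
    rw [norm_neg, norm_mul, norm_mul, norm_mul]
    calc ‖s‖ * ‖s + 1‖ * ‖(y : ℂ) - a‖ * ‖(y : ℂ) ^ (-s - 2)‖
        ≤ ‖s‖ * ‖s + 1‖ * 1 * a ^ (-s.re - 2) := by gcongr
      _ = _ := by ring
  have h := norm_image_sub_le_of_norm_deriv_le_segment' hderiv hbound x hx
  have hfa : f a = (a : ℂ) ^ (-s) := by simp [hf]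
  rw [hfa] at h
  exact h.trans (mul_le_of_le_one_right (by positivity) (by linarith [hx.2]))

lemma norm_trapezoidError_le {m : ℕ} (hm : 1 ≤ m) {s : ℂ} (hs : -2 ≤ s.re) :
    ‖trapezoidError m s‖ ≤ ‖s - 1‖ * (‖s‖ * ‖s + 1‖ * (m : ℝ) ^ (-s.re - 2)) := by
  set a : ℝ := (m : ℝ) with ha'
  have ha : 0 < a := Nat.cast_pos.2 hm
  set f : ℝ → ℂ := fun x ↦ (s - 1) / 2 * ((x - a) * ((a : ℂ) ^ (-s) + (x : ℂ) ^ (-s)))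
    + (x : ℂ) ^ (1 - s) with hf
  have hderiv : ∀ y ∈ Set.Icc a (a + 1), HasDerivWithinAt f
      (-((s - 1) / 2 * ((y : ℂ) ^ (-s) + s * (y - a) * (y : ℂ) ^ (-s - 1) - (a : ℂ) ^ (-s))))
      (Set.Icc a (a + 1)) y := by
    intro y hy
    have hy0 := ha.trans_le hy.1
    have h1 := hasDerivAt_ofReal_cpow hy0 (-s)
    have h2 := hasDerivAt_ofReal_cpow hy0 (1 - s)
    have h3 : HasDerivAt (fun x : ℝ ↦ (x : ℂ) - a) 1 y := by
      simpa using ((hasDerivAt_id (y : ℂ)).sub_const (a : ℂ)).comp_ofReal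
    refine (((((h3.mul (h1.const_add ((a : ℂ) ^ (-s)))).const_mul ((s - 1) / 2)).add
      h2)).congr_deriv ?_).hasDerivWithinAt
    rw [show 1 - s - 1 = -s by ring]
    ring
  have hbound : ∀ y ∈ Set.Ico a (a + 1),
      ‖-((s - 1) / 2 * ((y : ℂ) ^ (-s) + s * (y - a) * (y : ℂ) ^ (-s - 1) - (a : ℂ) ^ (-s)))‖
        ≤ ‖s - 1‖ * (‖s‖ * ‖s + 1‖ * a ^ (-s.re - 2)) := by
    intro y hy
    rw [norm_neg, norm_mul, norm_div, Complex.norm_ofNat]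
    have h := norm_cpow_tangent_error_le ha (Set.Ico_subset_Icc_self hy) hs
    gcongr
    linarith [norm_nonneg (s - 1)]
  have h := norm_image_sub_le_of_norm_deriv_le_segment' hderiv hbound (a + 1)
    (Set.right_mem_Icc.2 (by linarith))
  have hdiff : f (a + 1) - f a = trapezoidError m s := by
    simp only [hf, ha', trapezoidError]
    push_cast
    ring
  rw [hdiff] at h
  simpa using h

lemma sum_trapezoidError {A B : ℕ} (hAB : A ≤ B) (s : ℂ) :
    ∑ m ∈ Finset.Ico A B, trapezoidError m s
      = (s - 1) * (∑ m ∈ Finset.Ico A B, (m : ℂ) ^ (-s) - (A : ℂ) ^ (-s) / 2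
        + (B : ℂ) ^ (-s) / 2) - (A : ℂ) ^ (1 - s) + (B : ℂ) ^ (1 - s) := by
  induction B, hAB using Nat.le_induction with
  | base =>
    simp
  | succ B hB ih =>
    rw [Finset.sum_Ico_succ_top hB, Finset.sum_Ico_succ_top hB, ih, trapezoidError]
    ring

end TrapezoidRule

section EulerMaclaurin

open Filter Topology

lemma differentiable_trapezoidError {m : ℕ} (hm : 1 ≤ m) :
    Differentiable ℂ (trapezoidError m) := by
  have h : ∀ n : ℕ, 1 ≤ n → ∀ g : ℂ → ℂ, Differentiable ℂ g →
      Differentiable ℂ fun s ↦ (n : ℂ) ^ g s := fun n hn g hg ↦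
    hg.const_cpow (Or.inl (by exact_mod_cast (by omega : n ≠ 0)))
  have h1 := h m hm (fun s ↦ -s) (by fun_prop)
  have h2 := h (m + 1) (by omega) (fun s ↦ -s) (by fun_prop)
  have h3 := h m hm (fun s ↦ 1 - s) (by fun_prop)
  have h4 := h (m + 1) (by omega) (fun s ↦ 1 - s) (by fun_prop)
  unfold trapezoidError
  exact (((differentiable_id.sub_const 1).mul (h1.add h2)).div_const 2).sub (h3.sub h4)

lemma summable_rpow_neg_three_halves :
    Summable fun i : ℕ ↦ (((i + 1 : ℕ) : ℝ)) ^ (-(3 / 2) : ℝ) :=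
  (summable_nat_add_iff 1).2 (Real.summable_nat_rpow.2 (by norm_num))

lemma norm_trapezoidError_le_of_norm_le {R : ℝ} {s : ℂ} (hs : -(1 / 2) ≤ s.re) (hR : ‖s‖ ≤ R)
    (i : ℕ) : ‖trapezoidError (i + 1) s‖
      ≤ (R + 1) * (R * (R + 1)) * ((i + 1 : ℕ) : ℝ) ^ (-(3 / 2) : ℝ) := by
  have hR0 : 0 ≤ R := (norm_nonneg s).trans hR
  have h1 : ‖s - 1‖ ≤ R + 1 := (norm_sub_le s 1).trans (by simpa using hR)
  have h2 : ‖s + 1‖ ≤ R + 1 := (norm_add_le s 1).trans (by simpa using hR)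
  have h3 : ((i + 1 : ℕ) : ℝ) ^ (-s.re - 2) ≤ ((i + 1 : ℕ) : ℝ) ^ (-(3 / 2) : ℝ) :=
    Real.rpow_le_rpow_of_exponent_le (by norm_cast; omega) (by linarith)
  calc ‖trapezoidError (i + 1) s‖
      ≤ ‖s - 1‖ * (‖s‖ * ‖s + 1‖ * ((i + 1 : ℕ) : ℝ) ^ (-s.re - 2)) :=
        norm_trapezoidError_le (by omega) (by linarith)
    _ ≤ (R + 1) * (R * (R + 1) * ((i + 1 : ℕ) : ℝ) ^ (-(3 / 2) : ℝ)) := by gcongr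
    _ = _ := by ring

lemma summable_trapezoidError {s : ℂ} (hs : -(1 / 2) ≤ s.re) :
    Summable fun i : ℕ ↦ trapezoidError (i + 1) s :=
  Summable.of_norm_bounded (summable_rpow_neg_three_halves.mul_left _)
    (norm_trapezoidError_le_of_norm_le hs le_rfl)

lemma tendsto_natCast_succ_cpow_zero {z : ℂ} (hz : z.re < 0) :
    Tendsto (fun n : ℕ ↦ ((n + 1 : ℕ) : ℂ) ^ z) atTop (𝓝 0) := by
  rw [tendsto_zero_iff_norm_tendsto_zero]
  have h := (tendsto_rpow_neg_atTop (neg_pos.2 hz)).comp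
    (tendsto_natCast_atTop_atTop.comp (tendsto_add_atTop_nat 1))
  refine h.congr fun n ↦ ?_
  simp only [Function.comp_apply, neg_neg]
  rw [Complex.norm_natCast_cpow_of_pos (by omega)]

lemma sum_range_trapezoidError (K : ℕ) (s : ℂ) :
    ∑ i ∈ Finset.range K, trapezoidError (i + 1) s
      = (s - 1) * (∑ i ∈ Finset.range K, ((i + 1 : ℕ) : ℂ) ^ (-s) - 1 / 2
        + ((K + 1 : ℕ) : ℂ) ^ (-s) / 2) - 1 + ((K + 1 : ℕ) : ℂ) ^ (1 - s) := by
  have h := sum_trapezoidError (Nat.le_add_left 1 K) s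
  rw [Finset.sum_Ico_eq_sum_range, Finset.sum_Ico_eq_sum_range] at h
  simpa [add_comm 1] using h

lemma riemannZeta₁_eq_of_one_lt_re {s : ℂ} (hs : 1 < s.re) :
    riemannZeta₁ s = (s - 1) / 2 + 1 + ∑' i : ℕ, trapezoidError (i + 1) s := by
  have hs1 : s ≠ 1 := by
    rintro rfl
    simp at hs
  have hsum := (summable_trapezoidError (s := s) (by linarith)).hasSum.tendsto_sum_nat
  have hz : Tendsto (fun K : ℕ ↦ ∑ i ∈ Finset.range K, ((i + 1 : ℕ) : ℂ) ^ (-s)) atTop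
      (𝓝 (riemannZeta s)) := by
    have h1 : Summable fun i : ℕ ↦ 1 / ((i : ℂ) + 1) ^ s := by
      have h := (summable_nat_add_iff 1).2 (Complex.summable_one_div_nat_cpow.2 hs)
      simpa using h
    rw [zeta_eq_tsum_one_div_nat_add_one_cpow hs]
    refine h1.hasSum.tendsto_sum_nat.congr fun K ↦ Finset.sum_congr rfl fun i _ ↦ ?_
    rw [Complex.cpow_neg, one_div]
    push_cast
    rfl
  have hlim := ((((hz.sub_const (1 / 2)).add ((tendsto_natCast_succ_cpow_zero
    (z := -s) (by simpa using by linarith)).div_const 2)).const_mul (s - 1)).sub_const 1).add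
    (tendsto_natCast_succ_cpow_zero (z := 1 - s) (by simpa using hs))
  have heq := tendsto_nhds_unique (hsum.congr fun K ↦ sum_range_trapezoidError K s) hlim
  have h2 := riemannZeta_eq_inv_sub_mul hs1
  have h3 : (s - 1) * riemannZeta s = riemannZeta₁ s := by
    rw [h2]
    field_simp [sub_ne_zero.2 hs1]
  rw [heq, ← h3]
  ring

lemma riemannZeta₁_eq {s : ℂ} (hs : -(1 / 2) < s.re) :
    riemannZeta₁ s = (s - 1) / 2 + 1 + ∑' i : ℕ, trapezoidError (i + 1) s := by
  set R : ℝ := ‖s‖ + 3 with hR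
  set U : Set ℂ := {z : ℂ | -(1 / 2) < z.re} ∩ Metric.ball 0 R with hU
  have hUo : IsOpen U :=
    (isOpen_lt continuous_const Complex.continuous_re).inter Metric.isOpen_ball
  have hUc : IsPreconnected U :=
    ((convex_halfSpace_re_gt _).inter (convex_ball 0 R)).isPreconnected
  have hsU : s ∈ U := ⟨hs, by simp [hR]⟩
  have h2U : (2 : ℂ) ∈ U := by
    refine ⟨by norm_num, ?_⟩
    simp only [Metric.mem_ball, dist_zero_right, Complex.norm_ofNat, hR]
    linarith [norm_nonneg s]
  have hd : DifferentiableOn ℂ (fun s ↦ ∑' i : ℕ, trapezoidError (i + 1) s) U :=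
    differentiableOn_tsum_of_summable_norm (summable_rpow_neg_three_halves.mul_left _)
      (fun i ↦ (differentiable_trapezoidError (by omega)).differentiableOn) hUo
      (fun i w hw ↦ norm_trapezoidError_le_of_norm_le (le_of_lt hw.1)
        (by simpa using (Metric.mem_ball.1 hw.2).le) i)
  have hd' : DifferentiableOn ℂ
      (fun s ↦ (s - 1) / 2 + 1 + ∑' i : ℕ, trapezoidError (i + 1) s) U :=
    DifferentiableOn.add (Differentiable.differentiableOn (by fun_prop)) hd
  have hopen : {z : ℂ | 1 < z.re} ∈ 𝓝 (2 : ℂ) :=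
    (isOpen_lt continuous_const Complex.continuous_re).mem_nhds (by simp)
  exact (differentiable_riemannZeta₁.differentiableOn.analyticOnNhd
    hUo).eqOn_of_preconnected_of_eventuallyEq (hd'.analyticOnNhd hUo) hUc h2U
    (Filter.mem_of_superset hopen fun z hz ↦ riemannZeta₁_eq_of_one_lt_re hz) hsU

lemma norm_riemannZeta₁_sub_le {s : ℂ} (hs : -(1 / 2) < s.re) {A : ℕ} (hA : 1 ≤ A) {E : ℝ}
    (hE : ∀ B, A ≤ B → ‖∑ m ∈ Finset.Ico A B, trapezoidError m s‖ ≤ E) :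
    ‖riemannZeta₁ s - ((s - 1) * (∑ m ∈ Finset.Ico 1 A, (m : ℂ) ^ (-s) + (A : ℂ) ^ (-s) / 2)
      + (A : ℂ) ^ (1 - s))‖ ≤ E := by
  have hsum := (summable_trapezoidError hs.le).hasSum.tendsto_sum_nat
  have h1 := sum_trapezoidError hA s
  have h2 := hsum.sub_const (∑ m ∈ Finset.Ico 1 A, trapezoidError m s)
  rw [h1] at h2
  have h3 : riemannZeta₁ s - ((s - 1) * (∑ m ∈ Finset.Ico 1 A, (m : ℂ) ^ (-s)
      + (A : ℂ) ^ (-s) / 2) + (A : ℂ) ^ (1 - s)) = ∑' i : ℕ, trapezoidError (i + 1) s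
        - ((s - 1) * (∑ m ∈ Finset.Ico 1 A, (m : ℂ) ^ (-s) - ((1 : ℕ) : ℂ) ^ (-s) / 2
        + (A : ℂ) ^ (-s) / 2) - ((1 : ℕ) : ℂ) ^ (1 - s) + (A : ℂ) ^ (1 - s)) := by
    rw [riemannZeta₁_eq hs]
    simp only [Nat.cast_one, Complex.one_cpow]
    ring
  rw [h3]
  refine le_of_tendsto h2.norm (Filter.eventually_atTop.2 ⟨A, fun K hK ↦ ?_⟩)
  rw [← h1]
  have h4 : ∑ i ∈ Finset.range K, trapezoidError (i + 1) s
      = ∑ m ∈ Finset.Ico 1 (K + 1), trapezoidError m s := by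
    rw [Finset.sum_Ico_eq_sum_range]
    simp [add_comm 1]
  rw [h4, ← Finset.sum_Ico_consecutive _ hA (by omega : A ≤ K + 1), add_sub_cancel_left]
  exact hE (K + 1) (by omega)

end EulerMaclaurin

section LogarithmicPhase

/-- The increment `log (1 + 1/x)` of the logarithm. -/
noncomputable def logStep (x : ℝ) : ℝ := Real.log (1 + 1 / x)

lemma logStep_pos {x : ℝ} (hx : 0 < x) : 0 < logStep x :=
  Real.log_pos (by linarith [one_div_pos.2 hx])

lemma logStep_le {x : ℝ} (hx : 0 < x) : logStep x ≤ 1 / x :=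
  (Real.log_le_sub_one_of_pos (by positivity)).trans (by linarith)

lemma le_logStep {x : ℝ} (hx : 0 < x) : 2 / (2 * x + 1) ≤ logStep x := by
  have h := Real.le_log_one_add_of_nonneg (x := 1 / x) (by positivity)
  refine le_trans (le_of_eq ?_) h
  field_simp
  ring

lemma logStep_antitone {x y : ℝ} (hx : 0 < x) (hxy : x ≤ y) : logStep y ≤ logStep x := by
  have hy := hx.trans_le hxy
  unfold logStep
  gcongr

lemma logStep_sq_le {x : ℝ} (hx : 0 < x) : logStep x ^ 2 ≤ 1 / (x * (x + 1)) := by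
  have hpos := logStep_pos hx
  have h1 : logStep x / 2 ≤ Real.sinh (logStep x / 2) := Real.self_le_sinh_iff.2 (by linarith)
  have h2 : (2 * Real.sinh (logStep x / 2)) ^ 2
      = Real.exp (logStep x) - 2 + (Real.exp (logStep x))⁻¹ := by
    rw [← Real.exp_neg, Real.sinh_eq]
    have e1 : Real.exp (logStep x) = Real.exp (logStep x / 2) ^ 2 := by
      rw [← Real.exp_nat_mul]
      congr 1
      push_cast
      ring
    have e2 : Real.exp (-logStep x) = Real.exp (-(logStep x / 2)) ^ 2 := by
      rw [← Real.exp_nat_mul]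
      congr 1
      push_cast
      ring
    have e3 : Real.exp (logStep x / 2) * Real.exp (-(logStep x / 2)) = 1 := by
      rw [← Real.exp_add]
      simp
    rw [e1, e2]
    linear_combination (-2) * e3
  have h3 : Real.exp (logStep x) = 1 + 1 / x := Real.exp_log (by positivity)
  calc logStep x ^ 2 ≤ (2 * Real.sinh (logStep x / 2)) ^ 2 :=
        pow_le_pow_left₀ hpos.le (by linarith) 2
    _ = 1 / (x * (x + 1)) := by
        rw [h2, h3]
        field_simp
        ring

lemma antitoneOn_sub_inv_logStep :
    AntitoneOn (fun x : ℝ ↦ x + 1 / 2 - 1 / logStep x) (Set.Ioi 0) := by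
  have hd : ∀ x : ℝ, 0 < x → HasDerivAt (fun x : ℝ ↦ x + 1 / 2 - 1 / logStep x)
      (1 - 1 / (logStep x ^ 2 * (x * (x + 1)))) x := by
    intro x hx
    have hpos := logStep_pos hx
    have h1 : HasDerivAt (fun x : ℝ ↦ 1 + 1 / x) (-(1 / x ^ 2)) x := by
      simpa using ((hasDerivAt_inv hx.ne').const_add 1)
    have h2 : HasDerivAt logStep (-(1 / x ^ 2) / (1 + 1 / x)) x := h1.log (by positivity)
    have h3 := h2.inv hpos.ne'
    simp only [one_div]
    refine (((hasDerivAt_id x).add_const (2⁻¹ : ℝ)).sub h3).congr_deriv ?_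
    field_simp
  refine antitoneOn_of_deriv_nonpos (convex_Ioi 0)
    (fun x hx ↦ (hd x hx).continuousAt.continuousWithinAt)
    (fun x hx ↦ (hd x (interior_subset hx)).differentiableAt.differentiableWithinAt) ?_
  intro x hx
  have hx : 0 < x := interior_subset hx
  rw [(hd x hx).deriv, sub_nonpos]
  have hpos := logStep_pos hx
  rw [le_div_iff₀ (by positivity), one_mul]
  have h := logStep_sq_le hx
  rwa [le_div_iff₀ (by positivity)] at h

lemma sub_inv_logStep_mem {x : ℝ} (hx : 0 < x) :
    x + 1 / 2 - 1 / logStep x ∈ Set.Icc 0 (1 / 2) := by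
  have hpos := logStep_pos hx
  have h1 := logStep_le hx
  have h2 := le_logStep hx
  have h3 : x ≤ 1 / logStep x := by
    rw [le_div_iff₀ hpos]
    rw [le_div_iff₀ hx] at h1
    linarith
  have h4 : 1 / logStep x ≤ x + 1 / 2 := by
    rw [div_le_iff₀ hpos]
    rw [div_le_iff₀ (by positivity)] at h2
    linarith
  constructor <;> linarith

lemma monotoneOn_inv_sub_cot :
    MonotoneOn (fun y : ℝ ↦ 1 / y - Real.cot y) (Set.Ioc 0 1) := by
  have hlt : (1 : ℝ) < Real.pi := by linarith [Real.pi_gt_three]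
  have hd : ∀ y ∈ Set.Ioc (0 : ℝ) 1, HasDerivAt (fun y : ℝ ↦ 1 / y - Real.cot y)
      (1 / Real.sin y ^ 2 - 1 / y ^ 2) y := by
    intro y hy
    have hsin : 0 < Real.sin y := Real.sin_pos_of_pos_of_lt_pi hy.1 (by linarith [hy.2])
    have h1 : HasDerivAt (fun y : ℝ ↦ 1 / y) (-(1 / y ^ 2)) y := by
      simpa using hasDerivAt_inv hy.1.ne'
    have h2 : HasDerivAt Real.cot (-(1 / Real.sin y ^ 2)) y := by
      have h := (Real.hasDerivAt_cos y).div (Real.hasDerivAt_sin y) hsin.ne'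
      have hf : (Real.cos / Real.sin) = Real.cot := by
        funext z
        rw [Pi.div_apply, Real.cot_eq_cos_div_sin]
      rw [hf] at h
      refine h.congr_deriv ?_
      rw [← neg_div]
      congr 1
      linarith [Real.sin_sq_add_cos_sq y]
    exact (h1.sub h2).congr_deriv (by ring)
  refine monotoneOn_of_deriv_nonneg (convex_Ioc 0 1)
    (fun y hy ↦ (hd y hy).continuousAt.continuousWithinAt)
    (fun y hy ↦ (hd y (interior_subset hy)).differentiableAt.differentiableWithinAt) ?_
  intro y hy
  have hy := interior_subset hy
  have hsin : 0 < Real.sin y := Real.sin_pos_of_pos_of_lt_pi hy.1 (by linarith [hy.2])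
  rw [(hd y hy).deriv, sub_nonneg]
  gcongr
  exact Real.sin_le hy.1.le

lemma inv_sub_cot_mem {y : ℝ} (hy : y ∈ Set.Ioc (0 : ℝ) 1) :
    1 / y - Real.cot y ∈ Set.Icc 0 (y / 2) := by
  have hsin : 0 < Real.sin y :=
    Real.sin_pos_of_pos_of_lt_pi hy.1 (by linarith [hy.2, Real.pi_gt_three])
  have h1 := cot_le_inv hy.1 (by linarith [hy.2, Real.pi_gt_three])
  refine ⟨by linarith, ?_⟩
  have hy0 := hy.1
  have hcos : 0 ≤ 1 - y ^ 2 / 2 := by nlinarith [hy.1, hy.2]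
  have h2 : (1 - y ^ 2 / 2) / y ≤ Real.cot y := by
    rw [Real.cot_eq_cos_div_sin]
    gcongr
    · exact hcos.trans (Real.one_sub_sq_div_two_le_cos)
    · exact Real.one_sub_sq_div_two_le_cos
    · exact Real.sin_le hy.1.le
  have h3 : (1 - y ^ 2 / 2) / y = 1 / y - y / 2 := by
    field_simp
  linarith

end LogarithmicPhase

section ImaginaryAxis

/-- The weight with which `m ^ (-it) - (m + 1) ^ (-it)` enters the trapezoid error. -/
noncomputable def trapezoidWeight (t : ℝ) (m : ℕ) : ℝ :=
  (m + 1 / 2) / t - Real.cot (t * logStep m / 2) / 2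

lemma natCast_cpow_succ {m : ℕ} (hm : 1 ≤ m) (t : ℝ) :
    ((m + 1 : ℕ) : ℂ) ^ (-(t * I))
      = (m : ℂ) ^ (-(t * I)) * expTurn (-(t * logStep m / (2 * Real.pi))) := by
  have hm0 : (0 : ℝ) < m := by exact_mod_cast hm
  have hlog : Real.log ((m + 1 : ℕ) : ℝ) = Real.log m + logStep m := by
    rw [logStep, ← Real.log_mul hm0.ne' (by positivity)]
    congr 1
    push_cast
    field_simp
  have hπ : (Real.pi : ℂ) ≠ 0 := by exact_mod_cast Real.pi_ne_zero
  rw [Complex.cpow_def_of_ne_zero (by exact_mod_cast (by omega : m + 1 ≠ 0)),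
    Complex.cpow_def_of_ne_zero (by exact_mod_cast (by omega : m ≠ 0)), expTurn,
    ← Complex.exp_add, ← Complex.natCast_log, ← Complex.natCast_log, hlog]
  congr 1
  push_cast
  field_simp
  ring

lemma trapezoidError_mul_I {m : ℕ} (hm : 1 ≤ m) {t : ℝ} (ht : 0 < t) (htm : t ≤ m) :
    trapezoidError m (t * I) = -(t : ℂ) * ((trapezoidWeight t m : ℂ)
      * ((m : ℂ) ^ (-(t * I)) - ((m + 1 : ℕ) : ℂ) ^ (-(t * I)))) := by
  have hm0 : (0 : ℝ) < m := by exact_mod_cast hm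
  have hmc : (m : ℂ) ≠ 0 := by exact_mod_cast hm0.ne'
  have hmc1 : ((m + 1 : ℕ) : ℂ) ≠ 0 := by exact_mod_cast (by omega : m + 1 ≠ 0)
  have htc : (t : ℂ) ≠ 0 := by exact_mod_cast ht.ne'
  have hθ : 0 < t * logStep m := mul_pos ht (logStep_pos hm0)
  have hθ1 : t * logStep m ≤ 1 := by
    have h := mul_le_mul htm (logStep_le hm0) (logStep_pos hm0).le hm0.le
    rwa [mul_one_div_cancel hm0.ne'] at h
  set d : ℝ := -(t * logStep m / (2 * Real.pi)) with hd
  have hsin : Real.sin (Real.pi * d) ≠ 0 := by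
    have : Real.pi * d = -(t * logStep m / 2) := by
      rw [hd]
      field_simp
    rw [this, Real.sin_neg, neg_ne_zero]
    exact (Real.sin_pos_of_pos_of_lt_pi (by linarith) (by linarith [Real.pi_gt_three])).ne'
  have hcot : Real.cot (Real.pi * d) = -Real.cot (t * logStep m / 2) := by
    have : Real.pi * d = -(t * logStep m / 2) := by
      rw [hd]
      field_simp
    rw [this, Real.cot_eq_cos_div_sin, Real.cot_eq_cos_div_sin, Real.cos_neg, Real.sin_neg,
      div_neg]
  have h1 := one_sub_expTurn_mul hsin
  rw [hcot] at h1
  have e : ∀ z : ℂ, z ≠ 0 → z ^ (1 - (t : ℂ) * I) = z * z ^ (-((t : ℂ) * I)) := fun z hz ↦ by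
    rw [sub_eq_add_neg, Complex.cpow_add _ _ hz, Complex.cpow_one]
  rw [trapezoidError, e _ hmc, e _ hmc1, natCast_cpow_succ hm, ← hd, trapezoidWeight]
  generalize Real.cot (t * logStep m / 2) = c at *
  push_cast at h1 ⊢
  generalize (m : ℂ) ^ (-((t : ℂ) * I)) = u at *
  generalize expTurn d = q at *
  field_simp
  linear_combination (-2 * u * t * I) * h1 - (u * t * c * (1 - q)) * I_sq

lemma trapezoidWeight_eq {t : ℝ} (ht : 0 < t) {m : ℕ} (hm : 1 ≤ m) :
    trapezoidWeight t m = (m + 1 / 2 - 1 / logStep m) / t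
      + (1 / (t * logStep m / 2) - Real.cot (t * logStep m / 2)) / 2 := by
  have hpos := logStep_pos (x := m) (by exact_mod_cast hm)
  rw [trapezoidWeight]
  field_simp
  ring

lemma half_mul_logStep_mem {t : ℝ} (ht : 0 < t) {m : ℕ} (hm : 1 ≤ m) (htm : t ≤ m) :
    t * logStep m / 2 ∈ Set.Ioc (0 : ℝ) 1 := by
  have hm0 : (0 : ℝ) < m := by exact_mod_cast hm
  have hθ : 0 < t * logStep m := mul_pos ht (logStep_pos hm0)
  have h := mul_le_mul htm (logStep_le hm0) (logStep_pos hm0).le hm0.le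
  rw [mul_one_div_cancel hm0.ne'] at h
  constructor <;> linarith

lemma trapezoidWeight_succ_le {t : ℝ} (ht : 0 < t) {m : ℕ} (hm : 1 ≤ m) (htm : t ≤ m) :
    trapezoidWeight t (m + 1) ≤ trapezoidWeight t m := by
  have hm0 : (0 : ℝ) < m := by exact_mod_cast hm
  have hle : (m : ℝ) ≤ (m + 1 : ℕ) := by
    push_cast
    linarith
  have h1 := antitoneOn_sub_inv_logStep (Set.mem_Ioi.2 hm0) (Set.mem_Ioi.2 (hm0.trans_le hle)) hle
  have h2 := monotoneOn_inv_sub_cot (half_mul_logStep_mem ht (m := m + 1) (by omega)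
    (htm.trans hle)) (half_mul_logStep_mem ht hm htm)
    (by gcongr; exact logStep_antitone hm0 hle)
  rw [trapezoidWeight_eq ht hm, trapezoidWeight_eq ht (by omega)]
  simp only at h1 h2
  gcongr

lemma abs_trapezoidWeight_le {t : ℝ} (ht : 0 < t) {A m : ℕ} (hA : 1 ≤ A) (htA : t ≤ A)
    (hm : A ≤ m) : |trapezoidWeight t m| ≤ 1 / (2 * t) + t / (8 * A) := by
  have hA0 : (0 : ℝ) < A := by exact_mod_cast hA
  have hle : (A : ℝ) ≤ m := by exact_mod_cast hm
  have hm0 := hA0.trans_le hle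
  obtain ⟨h1, h2⟩ := sub_inv_logStep_mem hm0
  obtain ⟨h3, h4⟩ := inv_sub_cot_mem (half_mul_logStep_mem ht (by omega) (htA.trans hle))
  have h5 : logStep m ≤ 1 / A := (logStep_le hm0).trans (one_div_le_one_div_of_le hA0 hle)
  rw [trapezoidWeight_eq ht (by omega), abs_of_nonneg (by positivity)]
  calc (m + 1 / 2 - 1 / logStep m) / t
        + (1 / (t * logStep m / 2) - Real.cot (t * logStep m / 2)) / 2
      ≤ (1 / 2) / t + t * (1 / A) / 2 / 2 / 2 := by
        gcongr
        refine h4.trans ?_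
        gcongr
    _ = 1 / (2 * t) + t / (8 * A) := by
        field_simp
        ring

lemma norm_sum_trapezoidError_le {t : ℝ} (ht : 0 < t) {A : ℕ} (hA : 1 ≤ A) (htA : t ≤ A)
    (B : ℕ) : ‖∑ m ∈ Finset.Ico A B, trapezoidError m (t * I)‖ ≤ 2 + t * (t / A) := by
  have hA0 : (0 : ℝ) < A := by exact_mod_cast hA
  have htm : ∀ m : ℕ, A ≤ m → t ≤ m := fun m hm ↦ htA.trans (by exact_mod_cast hm)
  have h1 : ∑ m ∈ Finset.Ico A B, trapezoidError m (t * I)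
      = -(t : ℂ) * ∑ m ∈ Finset.Ico A B, (trapezoidWeight t m : ℂ)
        * ((m : ℂ) ^ (-(t * I)) - ((m + 1 : ℕ) : ℂ) ^ (-(t * I))) := by
    rw [Finset.mul_sum]
    refine Finset.sum_congr rfl fun m hm ↦ ?_
    have hm := (Finset.mem_Ico.1 hm).1
    exact trapezoidError_mul_I (hA.trans hm) ht (htm m hm)
  have h2 := norm_sum_mul_sub_le (u := fun m : ℕ ↦ (m : ℂ) ^ (-(t * I)))
    (h := trapezoidWeight t) (a := A) (b := B) (U := 1) (B := 1 / (2 * t) + t / (8 * A))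
    zero_le_one (by positivity)
    (fun m hm _ ↦ by
      rw [Complex.norm_natCast_cpow_of_pos (by omega)]
      simp)
    (fun m hm _ ↦ trapezoidWeight_succ_le ht (hA.trans hm) (htm m hm))
    (fun m hm _ ↦ abs_trapezoidWeight_le ht hA htA hm)
  rw [h1, norm_mul, norm_neg, Complex.norm_real, Real.norm_of_nonneg ht.le]
  calc t * ‖_‖ ≤ t * (4 * (1 / (2 * t) + t / (8 * A)) * 1) := by
        gcongr
    _ = 2 + t * (t / A) / 2 := by
        field_simp
        ring
    _ ≤ 2 + t * (t / A) := by linarith [show 0 ≤ t * (t / A) by positivity]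

/-- Approximation of `ζ(it)` by a partial sum of its Dirichlet series. -/
lemma norm_riemannZeta_mul_I_sub_le {t : ℝ} (ht : 0 < t) {A : ℕ} (hA : 1 ≤ A) (htA : t ≤ A) :
    ‖riemannZeta (t * I) - (∑ m ∈ Finset.Ico 1 A, (m : ℂ) ^ (-(t * I))
      + (A : ℂ) ^ (-(t * I)) / 2 + A * (A : ℂ) ^ (-(t * I)) / (t * I - 1))‖
      ≤ 2 / t + t / A := by
  have hA0 : (0 : ℝ) < A := by exact_mod_cast hA
  have hAc : (A : ℂ) ≠ 0 := by exact_mod_cast hA0.ne'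
  have h1 := norm_riemannZeta₁_sub_le (s := t * I) (by simp) hA
    fun B _ ↦ norm_sum_trapezoidError_le ht hA htA B
  have hnorm : t ≤ ‖(t : ℂ) * I - 1‖ := by
    have h := Complex.abs_im_le_norm ((t : ℂ) * I - 1)
    simpa [abs_of_pos ht] using h
  have hne : (t : ℂ) * I - 1 ≠ 0 := norm_pos_iff.1 (ht.trans_le hnorm)
  rw [sub_eq_add_neg 1, Complex.cpow_add _ _ hAc, Complex.cpow_one] at h1
  rw [riemannZeta_eq_inv_sub_mul (sub_ne_zero.1 hne)]
  have heq : ((t : ℂ) * I - 1)⁻¹ * riemannZeta₁ (t * I)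
      - (∑ m ∈ Finset.Ico 1 A, (m : ℂ) ^ (-(t * I)) + (A : ℂ) ^ (-(t * I)) / 2
        + A * (A : ℂ) ^ (-(t * I)) / (t * I - 1))
      = (riemannZeta₁ (t * I) - ((t * I - 1) * (∑ m ∈ Finset.Ico 1 A, (m : ℂ) ^ (-(t * I))
        + (A : ℂ) ^ (-(t * I)) / 2) + A * (A : ℂ) ^ (-(t * I)))) / (t * I - 1) := by
    field_simp
  rw [heq, norm_div, div_le_iff₀ (ht.trans_le hnorm)]
  refine h1.trans ?_
  calc 2 + t * (t / A) = (2 / t + t / A) * t := by field_simp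
    _ ≤ (2 / t + t / A) * ‖(t : ℂ) * I - 1‖ := by gcongr

end ImaginaryAxis

/-- The sum `∑_{n ≤ N} Im ζ(2πin / log k) / n`. -/
noncomputable def zetaImSum (k N : ℕ) : ℝ :=
  ∑ n ∈ Finset.range N,
    (riemannZeta ((2 * Real.pi / Real.log k * (n + 1) : ℝ) * I)).im / (n + 1)

section Assembly

variable {k : ℕ}

lemma natCast_cpow_im {m : ℕ} (hm : 1 ≤ m) (t : ℝ) :
    ((m : ℂ) ^ (-(t * I))).im = -Real.sin (t * Real.log m) := by
  rw [Complex.cpow_def_of_ne_zero (by exact_mod_cast (by omega : m ≠ 0)), ← Complex.natCast_log,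
    show (Real.log m : ℂ) * -((t : ℂ) * I) = ((-(t * Real.log m) : ℝ) : ℂ) * I by
      push_cast
      ring, Complex.exp_ofReal_mul_I_im, Real.sin_neg]

lemma abs_riemannZeta_mul_I_im_add_le {t : ℝ} (ht : 0 < t) {A : ℕ} (hA : 1 ≤ A) (htA : t ≤ A)
    (hperiod : (A : ℂ) ^ (-(t * I)) = 1) :
    |(riemannZeta (t * I)).im + (∑ m ∈ Finset.Ico 1 A, Real.sin (t * Real.log m)
      + A * (t / (1 + t ^ 2)))| ≤ 2 / t + t / A := by
  have h := norm_riemannZeta_mul_I_sub_le ht hA htA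
  rw [hperiod] at h
  refine le_trans (le_of_eq ?_) ((Complex.abs_im_le_norm _).trans h)
  have hinv : ((t : ℂ) * I - 1)⁻¹ = ((-(1 / (1 + t ^ 2)) : ℝ) : ℂ)
      + ((-(t / (1 + t ^ 2)) : ℝ) : ℂ) * I := by
    have hne : (1 + (t : ℂ) ^ 2) ≠ 0 := by
      exact_mod_cast (by positivity : (1 + t ^ 2) ≠ 0)
    refine inv_eq_of_mul_eq_one_right ?_
    push_cast
    field_simp
    linear_combination (-(t : ℂ) ^ 2) * I_sq
  have hdiv : ((A : ℂ) * 1 / ((t : ℂ) * I - 1)).im = -(A * (t / (1 + t ^ 2))) := by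
    rw [mul_one, div_eq_mul_inv, hinv, ← Complex.ofReal_natCast, Complex.im_ofReal_mul,
      Complex.add_im, Complex.ofReal_im, Complex.im_ofReal_mul, Complex.I_im]
    ring
  have hsum : (∑ m ∈ Finset.Ico 1 A, (m : ℂ) ^ (-(t * I))).im
      = -∑ m ∈ Finset.Ico 1 A, Real.sin (t * Real.log m) := by
    rw [Complex.im_sum, ← Finset.sum_neg_distrib]
    exact Finset.sum_congr rfl fun m hm ↦ natCast_cpow_im (Finset.mem_Ico.1 hm).1 t
  rw [Complex.sub_im, Complex.add_im, Complex.add_im, hsum, hdiv]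
  have : ((1 : ℂ) / 2).im = 0 := by norm_num
  rw [this]
  congr 1
  ring

lemma natCast_pow_cpow_eq_one (hk : 2 ≤ k) (L n : ℕ) :
    ((k ^ L : ℕ) : ℂ) ^ (-((2 * Real.pi / Real.log k * (n + 1) : ℝ) * I)) = 1 := by
  have hκ := one_half_lt_log_of_two_le hk
  have hκc : (Real.log k : ℂ) ≠ 0 := by exact_mod_cast (by linarith : Real.log k ≠ 0)
  have hne : ((k ^ L : ℕ) : ℂ) ≠ 0 :=
    Nat.cast_ne_zero.2 (pow_pos (by omega) L).ne'
  rw [Complex.cpow_def_of_ne_zero hne, ← Complex.natCast_log, Complex.exp_eq_one_iff]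
  refine ⟨-(L * (n + 1) : ℕ), ?_⟩
  rw [Nat.cast_pow, Real.log_pow]
  rw [Complex.natCast_log] at hκc
  push_cast
  field_simp

lemma sum_one_div_succ_sq_le (N : ℕ) : ∑ n ∈ Finset.range N, 1 / ((n : ℝ) + 1) ^ 2 ≤ 2 := by
  have h := sum_one_div_sq_le le_rfl (N + 1)
  rw [Finset.sum_Ico_eq_sum_range] at h
  simpa [add_comm] using h

lemma abs_zetaImSum_add_le (hk : 2 ≤ k) {N L : ℕ} (hL : 100 * k * N ≤ k ^ L) :
    |zetaImSum k N + (∑ m ∈ Finset.Ico 1 (k ^ L), sineSum N (Real.log m / Real.log k)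
      + (k : ℝ) ^ L * ∑ n ∈ Finset.range N, 2 * Real.pi / Real.log k
        / (1 + (2 * Real.pi / Real.log k * (n + 1)) ^ 2))| ≤ 20 * k := by
  have hκ := one_half_lt_log_of_two_le hk
  have hκk := log_natCast_le hk
  have hk' : (2 : ℝ) ≤ k := by exact_mod_cast hk
  have hπ := Real.pi_gt_three
  have hπ4 := Real.pi_lt_d2
  set α : ℝ := 2 * Real.pi / Real.log k with hα
  have hα0 : 0 < α := div_pos (by linarith) (by linarith)
  have hα13 : α ≤ 13 := by
    rw [hα, div_le_iff₀ (by linarith)]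
    linarith
  have hαk : 1 / α ≤ k := by
    rw [hα, one_div_div, div_le_iff₀ (by linarith)]
    nlinarith
  have hA : 1 ≤ k ^ L := Nat.one_le_pow _ _ (by omega)
  have hA0 : (0 : ℝ) < (k : ℝ) ^ L := by positivity
  have hLr : 100 * (k : ℝ) * N ≤ (k : ℝ) ^ L := by exact_mod_cast hL
  have hterm : ∀ n ∈ Finset.range N,
      |(riemannZeta ((α * (n + 1) : ℝ) * I)).im / (n + 1)
        + (∑ m ∈ Finset.Ico 1 (k ^ L),
          Real.sin (2 * Real.pi * (n + 1) * (Real.log m / Real.log k)) / (n + 1)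
        + (k : ℝ) ^ L * (α / (1 + (α * (n + 1)) ^ 2)))|
      ≤ 2 * k * (1 / ((n : ℝ) + 1) ^ 2) + 13 / (k : ℝ) ^ L := by
    intro n hn
    have hnN : (n : ℝ) + 1 ≤ N := by exact_mod_cast Finset.mem_range.1 hn
    have hn0 : (0 : ℝ) < (n : ℝ) + 1 := by positivity
    have htA : α * (n + 1) ≤ ((k ^ L : ℕ) : ℝ) := by
      push_cast
      calc α * (n + 1) ≤ 13 * N := by gcongr
        _ ≤ 100 * k * N := by
          gcongr
          linarith
        _ ≤ _ := hLr
    have h := abs_riemannZeta_mul_I_im_add_le (mul_pos hα0 hn0) hA htA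
      (natCast_pow_cpow_eq_one hk L n)
    have hsin : ∀ m : ℕ, Real.sin (2 * Real.pi * (n + 1) * (Real.log m / Real.log k))
        = Real.sin (α * (n + 1) * Real.log m) := fun m ↦ by
      congr 1
      rw [hα]
      ring
    simp only [hsin]
    rw [← Finset.sum_div]
    have heq : (riemannZeta ((α * (n + 1) : ℝ) * I)).im / (n + 1)
        + ((∑ m ∈ Finset.Ico 1 (k ^ L), Real.sin (α * (n + 1) * Real.log m)) / (n + 1)
        + (k : ℝ) ^ L * (α / (1 + (α * (n + 1)) ^ 2)))
        = ((riemannZeta ((α * (n + 1) : ℝ) * I)).im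
          + (∑ m ∈ Finset.Ico 1 (k ^ L), Real.sin (α * (n + 1) * Real.log m)
          + (k ^ L : ℕ) * (α * (n + 1) / (1 + (α * (n + 1)) ^ 2)))) / (n + 1) := by
      push_cast
      field_simp
    rw [heq, abs_div, abs_of_pos hn0, div_le_iff₀ hn0]
    refine h.trans ?_
    push_cast
    calc 2 / (α * (n + 1)) + α * (n + 1) / (k : ℝ) ^ L
        = 2 * (1 / α) * (1 / ((n : ℝ) + 1) ^ 2) * (n + 1) + α / (k : ℝ) ^ L * (n + 1) := by
          field_simp
      _ ≤ 2 * k * (1 / ((n : ℝ) + 1) ^ 2) * (n + 1) + 13 / (k : ℝ) ^ L * (n + 1) := by gcongr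
      _ = _ := by ring
  have hswap : zetaImSum k N + (∑ m ∈ Finset.Ico 1 (k ^ L), sineSum N (Real.log m / Real.log k)
      + (k : ℝ) ^ L * ∑ n ∈ Finset.range N, α / (1 + (α * (n + 1)) ^ 2))
      = ∑ n ∈ Finset.range N, ((riemannZeta ((α * (n + 1) : ℝ) * I)).im / (n + 1)
        + (∑ m ∈ Finset.Ico 1 (k ^ L),
          Real.sin (2 * Real.pi * (n + 1) * (Real.log m / Real.log k)) / (n + 1)
        + (k : ℝ) ^ L * (α / (1 + (α * (n + 1)) ^ 2)))) := by
    rw [Finset.sum_add_distrib, Finset.sum_add_distrib, Finset.sum_comm, Finset.mul_sum]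
    rfl
  rw [hswap]
  refine (Finset.abs_sum_le_sum_abs _ _).trans ((Finset.sum_le_sum hterm).trans ?_)
  rw [Finset.sum_add_distrib, ← Finset.mul_sum, Finset.sum_const, Finset.card_range, nsmul_eq_mul]
  have h1 : (N : ℝ) * (13 / (k : ℝ) ^ L) ≤ 1 := by
    rw [← mul_div_assoc, div_le_one hA0]
    nlinarith [Nat.cast_nonneg (α := ℝ) N]
  nlinarith [sum_one_div_succ_sq_le N]

lemma abs_sum_sineSum_add_le (hk : 2 ≤ k) {N L : ℕ} (hN : 256 ≤ N) (hL1 : 100 * k * N ≤ k ^ L)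
    (hL2 : k ^ L ≤ 100 * k ^ 2 * N) :
    |∑ m ∈ Finset.Ico 1 (k ^ L), sineSum N (Real.log m / Real.log k)
      + Real.pi * sawtoothMean k * (k : ℝ) ^ L| ≤ 1000000 * (k : ℝ) ^ 8 + 40 := by
  have h1 := abs_sum_windows_le hk hN hL1 hL2
  have h2 := abs_sum_sawtooth_le hk L
  have h3 := sum_sineDefect hk N L
  simp only [sineDefect, Finset.sum_sub_distrib, ← Finset.mul_sum] at h3
  have hπ := Real.pi_pos
  have hπ4 := Real.pi_lt_d2
  set S := ∑ m ∈ Finset.Ico 1 (k ^ L), (1 / 2 - Real.log m / Real.log k + Nat.log k m)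
  have heq : ∑ m ∈ Finset.Ico 1 (k ^ L), sineSum N (Real.log m / Real.log k)
      + Real.pi * sawtoothMean k * (k : ℝ) ^ L
      = (∑ j ∈ Finset.range L, (rightWindowSum k N (k ^ j) - leftWindowSum k N (k ^ j))
        - leftWindowSum k N (k ^ L))
        + Real.pi * (S - L / 2 + sawtoothMean k * (k : ℝ) ^ L) := by
    rw [Finset.sum_sub_distrib]
    linear_combination h3
  rw [heq]
  refine (abs_add_le _ _).trans (add_le_add h1 ?_)
  rw [abs_mul, abs_of_pos hπ]
  nlinarith [abs_nonneg (S - L / 2 + sawtoothMean k * (k : ℝ) ^ L)]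

lemma abs_zetaImSum_le (hk : 2 ≤ k) {N : ℕ} (hN : 256 ≤ N) :
    |zetaImSum k N| ≤ 2000000 * (k : ℝ) ^ 8 := by
  have hκ := one_half_lt_log_of_two_le hk
  have hκk := log_natCast_le hk
  have hk' : (2 : ℝ) ≤ k := by exact_mod_cast hk
  have hπ := Real.pi_gt_three
  have hN0 : (0 : ℝ) < N := by exact_mod_cast (by omega : 0 < N)
  have hbig : 1 < 100 * k * N := by nlinarith
  set L := Nat.clog k (100 * k * N) with hL
  have hL1 : 100 * k * N ≤ k ^ L := Nat.le_pow_clog (by omega) _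
  have hL2 : k ^ L ≤ 100 * k ^ 2 * N := by
    have h1 := Nat.pow_pred_clog_lt_self (b := k) (by omega) hbig
    have h2 : 0 < L := Nat.clog_pos (by omega) hbig
    rw [← hL, Nat.pred_eq_sub_one] at h1
    calc k ^ L = k * k ^ (L - 1) := by rw [← pow_succ', Nat.sub_add_cancel h2]
      _ ≤ k * (100 * k * N) := Nat.mul_le_mul_left _ h1.le
      _ = _ := by ring
  have h1 := abs_zetaImSum_add_le hk hL1
  have h2 := abs_sum_sineSum_add_le hk hN hL1 hL2
  have h3 := abs_sum_lorentzian_sub_le hk (by omega : 1 ≤ N) rfl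
  set α : ℝ := 2 * Real.pi / Real.log k with hα
  have hα0 : 0 < α := div_pos (by linarith) (by linarith)
  have hαk : 1 / α ≤ k := by
    rw [hα, one_div_div, div_le_iff₀ (by linarith)]
    nlinarith
  set Λ := ∑ n ∈ Finset.range N, α / (1 + (α * (n + 1)) ^ 2)
  set T := ∑ m ∈ Finset.Ico 1 (k ^ L), sineSum N (Real.log m / Real.log k)
  have hL2r : (k : ℝ) ^ L ≤ 100 * (k : ℝ) ^ 2 * N := by exact_mod_cast hL2
  have h4 : |(k : ℝ) ^ L * (Λ - Real.pi * sawtoothMean k)| ≤ 200 * (k : ℝ) ^ 3 := by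
    rw [abs_mul, abs_of_pos (by positivity)]
    calc (k : ℝ) ^ L * |Λ - Real.pi * sawtoothMean k|
        ≤ (100 * (k : ℝ) ^ 2 * N) * (2 / (α * N)) := by gcongr
      _ = 200 * (k : ℝ) ^ 2 * (1 / α) := by
          field_simp
          ring
      _ ≤ 200 * (k : ℝ) ^ 2 * k := by gcongr
      _ = _ := by ring
  have heq : zetaImSum k N = (zetaImSum k N + (T + (k : ℝ) ^ L * Λ))
      - (T + Real.pi * sawtoothMean k * (k : ℝ) ^ L)
      - (k : ℝ) ^ L * (Λ - Real.pi * sawtoothMean k) := by ring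
  have h5 : (k : ℝ) ^ 3 ≤ (k : ℝ) ^ 8 := pow_le_pow_right₀ (by linarith) (by norm_num)
  have h6 : (k : ℝ) ≤ (k : ℝ) ^ 8 := le_self_pow₀ (by linarith) (by norm_num)
  rw [abs_le] at h1 h2 h4 ⊢
  constructor <;> linarith [heq, h1.1, h1.2, h2.1, h2.2, h4.1, h4.2]

lemma sum_Icc_neg_erase_zero {E : Type*} [AddCommMonoid E] (f : ℤ → E) (N : ℕ) :
    ∑ n ∈ (Finset.Icc (-(N : ℤ)) N).erase 0, f n
      = ∑ i ∈ Finset.range N, (f (i + 1) + f (-(i + 1))) := by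
  induction N with
  | zero => simp
  | succ N ih =>
    have h : (Finset.Icc (-((N + 1 : ℕ) : ℤ)) (N + 1 : ℕ)).erase 0
        = insert ((N : ℤ) + 1) (insert (-((N : ℤ) + 1))
          ((Finset.Icc (-(N : ℤ)) N).erase 0)) := by
      ext x
      simp only [Finset.mem_erase, Finset.mem_Icc, Finset.mem_insert]
      omega
    rw [h, Finset.sum_insert (by simp; omega), Finset.sum_insert (by simp), ih,
      Finset.sum_range_succ, ← add_assoc, add_comm]

lemma sum_riemannZeta_div (k N : ℕ) :
    1 / (2 * (Real.pi : ℂ) * I) * ∑ n ∈ (Finset.Icc (-(N : ℤ)) N).erase 0,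
      riemannZeta (2 * (n : ℂ) * (Real.pi : ℂ) * I / (Real.log k : ℂ)) / (n : ℂ)
      = ((zetaImSum k N / Real.pi : ℝ) : ℂ) := by
  have hπ : (Real.pi : ℂ) ≠ 0 := by exact_mod_cast Real.pi_ne_zero
  rw [sum_Icc_neg_erase_zero, zetaImSum, Finset.mul_sum, Finset.sum_div, Complex.ofReal_sum]
  refine Finset.sum_congr rfl fun i _ ↦ ?_
  have hi : ((i : ℂ) + 1) ≠ 0 := by exact_mod_cast (by omega : i + 1 ≠ 0)
  set t : ℝ := 2 * Real.pi / Real.log k * (i + 1) with ht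
  have h1 : 2 * (((i : ℤ) + 1 : ℤ) : ℂ) * (Real.pi : ℂ) * I / (Real.log k : ℂ) = t * I := by
    rw [ht]
    push_cast
    ring
  have h2 : 2 * ((-((i : ℤ) + 1) : ℤ) : ℂ) * (Real.pi : ℂ) * I / (Real.log k : ℂ)
      = (starRingEnd ℂ) (t * I) := by
    rw [ht]
    simp only [map_mul, Complex.conj_ofReal, Complex.conj_I]
    push_cast
    ring
  have h3 := Complex.sub_conj (riemannZeta (t * I))
  rw [h1, h2, riemannZeta_conj]
  push_cast at h3 ⊢
  generalize riemannZeta (t * I) = z at *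
  field_simp
  linear_combination h3

end Assembly

/-- for an integer `k ≥ 2`, the partial sums
`(1/(2πi)) ∑_{0<|n|≤k^l} ζ(2nπi/log k)/n` are bounded by a constant depending only
on `k`, for every real `l ≥ 2`. -/
theorem stmt_18 (k : ℕ) (hk : 2 ≤ k) :
    ∃ C : ℝ, ∀ l : ℝ, 2 ≤ l →
      ‖(1 / (2 * (Real.pi : ℂ) * I)) *
          ∑ n ∈ (Finset.Icc (-⌊(k : ℝ) ^ l⌋) ⌊(k : ℝ) ^ l⌋).erase 0,
            riemannZeta (2 * (n : ℂ) * (Real.pi : ℂ) * I / (Real.log k : ℂ)) / (n : ℂ)‖ ≤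
        C := by
  refine ⟨2000000 * (k : ℝ) ^ 8 + ∑ N ∈ Finset.range 256, |zetaImSum k N|, fun l _ ↦ ?_⟩
  obtain ⟨N, hN⟩ := Int.eq_ofNat_of_zero_le (Int.floor_nonneg.2 (by positivity : 0 ≤ (k : ℝ) ^ l))
  rw [hN, sum_riemannZeta_div, Complex.norm_real, Real.norm_eq_abs, abs_div,
    abs_of_pos Real.pi_pos]
  refine (div_le_self (abs_nonneg _) (by linarith [Real.pi_gt_three])).trans ?_
  rcases lt_or_ge N 256 with h | h
  · have h1 := Finset.single_le_sum (f := fun N ↦ |zetaImSum k N|)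
      (fun _ _ ↦ abs_nonneg _) (Finset.mem_range.2 h)
    exact h1.trans (le_add_of_nonneg_left (by positivity))
  · exact (abs_zetaImSum_le hk h).trans
      (le_add_of_nonneg_right (Finset.sum_nonneg fun _ _ ↦ abs_nonneg _))
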